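/- arXiv:1304.7482 — 2 statements merged into one kernel-verified Lean document; each statement's English description precedes it below -/
import Mathlib

section
/- Let (V, A) be an affine curvature model with dim V = 2. Then the following are equivalent: (i) (V,A) is an affine projective Osserman model; (ii) ρ(x,x) ≠ 0 for every nonzero x ∈ V; (iii) the symmetric Ricci form ρ_s is definite (either ρ_s(x,x) > 0 for all nonzero x, or ρ_s(x,x) < 0 for all nonzero x). -/
open Polynomial

variable (V : Type*) [AddCommGroup V] [Module ℝ V]

/-- The Jacobi operator of a trilinear curvature tensor: `J(v) : w ↦ A(w,v)v`. -/
noncomputable def jacOp (A : V →ₗ[ℝ] V →ₗ[ℝ] V →ₗ[ℝ] V) (v : V) : V →ₗ[ℝ] V :=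
  (LinearMap.flip (A.flip v)) v

/-- The Ricci tensor of a trilinear curvature tensor: `ρ(x,y) = Tr(z ↦ A(z,x)y)`. -/
noncomputable def ricci (A : V →ₗ[ℝ] V →ₗ[ℝ] V →ₗ[ℝ] V) (x y : V) : ℝ :=
  LinearMap.trace ℝ V ((LinearMap.flip (A.flip x)) y)

/-- The symmetrized Ricci tensor `ρ_s(x,y) = (ρ(x,y)+ρ(y,x))/2`. -/
noncomputable def riccis (A : V →ₗ[ℝ] V →ₗ[ℝ] V →ₗ[ℝ] V) (x y : V) : ℝ :=
  (ricci V A x y + ricci V A y x) / 2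

/-- The spectrum: the set of complex roots of the characteristic polynomial. -/
noncomputable def spec [FiniteDimensional ℝ V] (f : V →ₗ[ℝ] V) : Set ℂ :=
  (LinearMap.charpoly f).rootSet ℂ

/-- A singular endomorphism of a plane has characteristic roots `0` and its trace. -/
theorem spec_eq_pair_of_apply_eq_zero {W : Type*} [AddCommGroup W] [Module ℝ W]
    [FiniteDimensional ℝ W] (hdim : Module.finrank ℝ W = 2) (f : W →ₗ[ℝ] W) {v : W}
    (hv : v ≠ 0) (hfv : f v = 0) :
    spec W f = {0, ((LinearMap.trace ℝ W f : ℝ) : ℂ)} := by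
  have hdet : LinearMap.det f = 0 := by
    by_contra h
    have hinj := LinearMap.ker_eq_bot.1
      (LinearMap.isUnit_iff_ker_eq_bot f |>.1 ((LinearMap.isUnit_iff_isUnit_det f).2
        (isUnit_iff_ne_zero.2 h)))
    exact hv (hinj (by simpa using hfv))
  let b := Module.finBasisOfFinrankEq ℝ W hdim
  have hchar : f.charpoly = X ^ 2 - C (LinearMap.trace ℝ W f) * X := by
    rw [← LinearMap.charpoly_toMatrix f b, Matrix.charpoly_fin_two, LinearMap.det_toMatrix,
      ← LinearMap.trace_eq_matrix_trace ℝ b, hdet]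
    simp
  ext z
  rw [spec, mem_rootSet_of_ne f.charpoly_monic.ne_zero, hchar]
  have : aeval z (X ^ 2 - C (LinearMap.trace ℝ W f) * X)
      = z * (z - ((LinearMap.trace ℝ W f : ℝ) : ℂ)) := by
    simp
    ring
  rw [this, mul_eq_zero, sub_eq_zero]
  rfl

/-- The Ricci form does not take both signs on the diagonal if it has no nonzero null vector. -/
theorem ricci_self_neg_of_neg {W : Type*} [AddCommGroup W] [Module ℝ W]
    (A : W →ₗ[ℝ] W →ₗ[ℝ] W →ₗ[ℝ] W) (h : ∀ x : W, x ≠ 0 → ricci W A x x ≠ 0) {x y : W}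
    (hx : x ≠ 0) (hy : ricci W A y y < 0) : ricci W A x x < 0 := by
  by_contra! hx'
  have hpos : 0 < ricci W A x x := lt_of_le_of_ne hx' (h x hx).symm
  have hexp (t : ℝ) : ricci W A (x + t • y) (x + t • y) = ricci W A y y * (t * t)
      + (ricci W A x y + ricci W A y x) * t + ricci W A x x := by
    have hop : (A.flip (x + t • y)).flip (x + t • y) = (A.flip x).flip x
        + t • (A.flip x).flip y + t • (A.flip y).flip x + (t * t) • (A.flip y).flip y := by
      ext z
      simp [mul_smul]
      abel
    rw [ricci, hop]
    simp only [ricci, map_add, map_smul, smul_eq_mul]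
    ring
  obtain ⟨t, ht⟩ := exists_quadratic_eq_zero (a := ricci W A y y)
    (b := ricci W A x y + ricci W A y x) (c := ricci W A x x) hy.ne
    ⟨√(discrim (ricci W A y y) (ricci W A x y + ricci W A y x) (ricci W A x x)), by
      rw [Real.mul_self_sqrt]
      rw [discrim]
      nlinarith [sq_nonneg (ricci W A x y + ricci W A y x), mul_pos hpos (neg_pos.2 hy)]⟩
  refine h (x + t • y) (fun h0 => ?_) ((hexp t).trans ht)
  have hxy : x = (-t) • y := by rw [neg_smul]; exact eq_neg_of_add_eq_zero_left h0
  have hsq : ricci W A x x = t * t * ricci W A y y := by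
    have hop : (A.flip x).flip x = (t * t) • (A.flip y).flip y := by
      ext z
      simp [hxy, mul_smul]
    simp only [ricci, hop, map_smul, smul_eq_mul]
  nlinarith [mul_self_nonneg t]

/-- Theorem 1.9(2): for a 2-dimensional affine curvature model, the following are
equivalent: (i) it is an affine projective Osserman model; (ii) `ρ(x,x) ≠ 0` for
every nonzero `x`; (iii) the symmetric Ricci form `ρ_s` is definite. -/
theorem stmt_6 [FiniteDimensional ℝ V]
    (A : V →ₗ[ℝ] V →ₗ[ℝ] V →ₗ[ℝ] V)
    (hanti : ∀ x y z : V, A x y z = - A y x z)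
    (hbianchi : ∀ x y z : V, A x y z + A y z x + A z x y = 0)
    (hdim : Module.finrank ℝ V = 2) :
    ((∀ v w : V, v ≠ 0 → w ≠ 0 → ∃ s : ℝ, s ≠ 0 ∧
        spec V (jacOp V A v) = (fun μ : ℂ => (s : ℂ) * μ) '' spec V (jacOp V A w) ∧
        spec V (jacOp V A v) ≠ {0})
      ↔ (∀ x : V, x ≠ 0 → ricci V A x x ≠ 0)) ∧
    ((∀ x : V, x ≠ 0 → ricci V A x x ≠ 0)
      ↔ ((∀ x : V, x ≠ 0 → 0 < riccis V A x x) ∨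
          (∀ x : V, x ≠ 0 → riccis V A x x < 0))) := by
  have hzero (v : V) : A v v v = 0 := by
    have h2 : (2 : ℝ) • A v v v = 0 := by
      rw [two_smul]
      exact eq_neg_iff_add_eq_zero.1 (hanti v v v)
    exact (smul_eq_zero.1 h2).resolve_left two_ne_zero
  have hspec (v : V) (hv : v ≠ 0) : spec V (jacOp V A v) = {0, ((ricci V A v v : ℝ) : ℂ)} :=
    spec_eq_pair_of_apply_eq_zero hdim _ hv (hzero v)
  have hself (x : V) : riccis V A x x = ricci V A x x := by
    rw [riccis]
    ring
  refine ⟨⟨fun h x hx hric => ?_, fun h v w hv hw => ?_⟩, fun h => ?_, ?_⟩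
  · obtain ⟨s, -, -, hne⟩ := h x x hx hx
    exact hne (by simp [hspec x hx, hric])
  · refine ⟨ricci V A v v / ricci V A w w, div_ne_zero (h v hv) (h w hw), ?_, fun h0 => ?_⟩
    · have hw' : ((ricci V A w w : ℝ) : ℂ) ≠ 0 := by exact_mod_cast h w hw
      rw [hspec v hv, hspec w hw, Set.image_pair]
      simp [hw']
    · have hmem : ((ricci V A v v : ℝ) : ℂ) ∈ spec V (jacOp V A v) := by simp [hspec v hv]
      rw [h0] at hmem
      exact h v hv (by simpa using hmem)
  · simp only [hself]
    by_cases hneg : ∃ y, ricci V A y y < 0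
    · obtain ⟨y, hy⟩ := hneg
      exact .inr fun x hx => ricci_self_neg_of_neg A h hx hy
    · push Not at hneg
      exact .inl fun x hx => lt_of_le_of_ne (hneg x) (h x hx).symm
  · simp only [hself]
    rintro (h | h) x hx
    · exact (h x hx).ne'
    · exact (h x hx).ne
end

section
/- Let (V, A) be an affine projective Osserman curvature model of odd dimension m ≥ 3. Then for every nonzero v ∈ V, setting λ(v) := ρ(v,v)/(m−1), one has λ(v) ∈ ℝ with λ(v) ≠ 0, and the characteristic polynomial of the Jacobi operator J(v) equals t·(t − λ(v))^{m−1}; in particular Spec{J(v)} = {0, λ(v)}, the eigenvalue 0 has multiplicity 1 and λ(v) has multiplicity m−1. Moreover the symmetric Ricci form ρ_s is definite: either ρ_s(v,v) > 0 for all nonzero v, or ρ_s(v,v) < 0 for all nonzero v. -/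
open Polynomial

variable (V : Type*) [AddCommGroup V] [Module ℝ V]

section

open Matrix

/-- The determinant of `1 + t M` is polynomial in `t`, of degree at most the dimension. -/
lemma exists_polynomial_eval_eq_det_one_add_smul {E : Type*} [NormedAddCommGroup E]
    [NormedSpace ℝ E] [FiniteDimensional ℝ E] (M : E →L[ℝ] E) :
    ∃ p : ℝ[X], p.degree < (Module.finrank ℝ E + 1 : ℕ) ∧
      ∀ t : ℝ, p.eval t = (1 + t • M).det := by
  classical
  let b := Module.finBasis ℝ E
  set B := LinearMap.toMatrix b b (M : E →ₗ[ℝ] E)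
  refine ⟨((X : ℝ[X]) • B.map C + (1 : Matrix _ _ ℝ).map C).det, ?_, fun t => ?_⟩
  · refine lt_of_le_of_lt (degree_le_natDegree (R := ℝ)) ?_
    have := natDegree_det_X_add_C_le B 1
    rw [Fintype.card_fin] at this
    exact_mod_cast Nat.lt_succ_of_le this
  · rw [← coe_evalRingHom, RingHom.map_det]
    have h : ((1 + t • M : E →L[ℝ] E) : E →ₗ[ℝ] E) = LinearMap.id + t • (M : E →ₗ[ℝ] E) := rfl
    rw [ContinuousLinearMap.det, h, ← LinearMap.det_toMatrix b]
    congr 1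
    simp only [map_add, map_smul, LinearMap.toMatrix_id]
    ext i j
    by_cases hij : i = j <;> simp [B, hij] <;> ring

lemma det_one_add_pos {E : Type*} [NormedAddCommGroup E]
    [NormedSpace ℝ E] [FiniteDimensional ℝ E] (M : E →L[ℝ] E) (hM : ‖M‖ < 1) :
    0 < (1 + M).det := by
  have hcont : Continuous fun s : ℝ => (1 + s • M).det :=
    ContinuousLinearMap.continuous_det.comp (by fun_prop)
  by_contra hneg
  rw [not_lt] at hneg
  obtain ⟨s, hs, hs0⟩ := intermediate_value_Icc' (zero_le_one (α := ℝ)) hcont.continuousOn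
    (show (0 : ℝ) ∈ Set.Icc ((1 + (1 : ℝ) • M).det) ((1 + (0 : ℝ) • M).det) by
      simp only [one_smul, zero_smul, add_zero]
      exact ⟨hneg, by rw [ContinuousLinearMap.det]; simp⟩)
  have hn : ‖-(s • M)‖ < 1 := by
    rw [norm_neg, norm_smul, Real.norm_eq_abs, abs_of_nonneg hs.1]
    nlinarith [hs.1, hs.2, norm_nonneg M]
  have hu := isUnit_one_sub_of_norm_lt_one hn
  rw [sub_neg_eq_add] at hu
  obtain ⟨u, hu⟩ := hu
  have : (1 + s • M).det * (↑u⁻¹ : E →L[ℝ] E).det = 1 := by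
    rw [ContinuousLinearMap.det, ContinuousLinearMap.det, ← LinearMap.det_comp,
      ← ContinuousLinearMap.toLinearMap_comp, ← ContinuousLinearMap.mul_def, ← hu, Units.mul_inv]
    exact LinearMap.det_id
  simp only at hs0
  rw [hs0, zero_mul] at this
  exact zero_ne_one this

/-- An odd power of `1 + t ^ 2` is not the square of a polynomial. -/
lemma sq_ne_one_add_sq_pow (Q : ℝ[X]) (k : ℕ) : Q ^ 2 ≠ (1 + X ^ 2) ^ (2 * k + 1) := by
  intro h
  have hp : (1 + X ^ 2 : ℝ[X]) ≠ 0 := fun h0 => by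
    have := congrArg (eval 0) h0
    simp at this
  have hdvd : (1 + X ^ 2 : ℝ[X]) ^ k ∣ Q := by
    refine (UniqueFactorizationMonoid.pow_dvd_pow_iff_dvd two_ne_zero).1 ?_
    rw [h, ← pow_mul, mul_comm]
    exact pow_dvd_pow _ (by omega)
  obtain ⟨R, rfl⟩ := hdvd
  have hR : R ^ 2 = 1 + X ^ 2 := by
    have : (1 + X ^ 2 : ℝ[X]) ^ (2 * k) * R ^ 2 = (1 + X ^ 2) ^ (2 * k) * (1 + X ^ 2) := by
      rw [← pow_succ, ← h]; ring
    exact mul_left_cancel₀ (pow_ne_zero _ hp) this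
  have hI : aeval Complex.I R = 0 := by
    have := congrArg (aeval Complex.I) hR
    simpa using this
  have := congrArg (fun q => aeval Complex.I (derivative q)) hR
  simp [derivative_pow, hI] at this

open MeasureTheory in
/-- Milnor's volume argument: a norm-preserving Lipschitz tangent field on an odd-dimensional
Euclidean space does not exist. -/
lemma no_lipschitz_unit_tangent_field {E : Type*} [NormedAddCommGroup E]
    [InnerProductSpace ℝ E] [FiniteDimensional ℝ E] (hodd : Odd (Module.finrank ℝ E))
    (Y : E → E) (L : NNReal) (hL : LipschitzWith L Y)
    (hd : ∀ x, x ≠ 0 → DifferentiableAt ℝ Y x)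
    (hn : ∀ x, ‖Y x‖ = ‖x‖) (ht : ∀ x, inner ℝ x (Y x) = 0) : False := by
  classical
  let _ : MeasurableSpace E := borel E
  have : BorelSpace E := ⟨rfl⟩
  have : Nontrivial E := Module.nontrivial_of_finrank_pos (R := ℝ) hodd.pos
  set m := Module.finrank ℝ E
  let μ : Measure E := Measure.addHaar
  let s : Set E := Metric.ball 0 1 \ {0}
  have hs : MeasurableSet s := Metric.isOpen_ball.measurableSet.diff (measurableSet_singleton 0)
  let f : ℝ → E → E := fun t x => x + t • Y x
  have hfn : ∀ t x, ‖f t x‖ = √(1 + t ^ 2) * ‖x‖ := by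
    intro t x
    have h1 : ‖f t x‖ ^ 2 = (1 + t ^ 2) * ‖x‖ ^ 2 := by
      simp only [f]
      rw [norm_add_sq_real, inner_smul_right, ht, norm_smul, hn, mul_pow, Real.norm_eq_abs, sq_abs]
      ring
    rw [← Real.sqrt_sq (norm_nonneg (f t x)), h1, Real.sqrt_mul (by positivity),
      Real.sqrt_sq (norm_nonneg _)]
  let δ : ℝ := 1 / (L + 1)
  have hδ : 0 < δ := by positivity
  have hδL : ∀ t : ℝ, 0 ≤ t → t < δ → t * L < 1 := by
    intro t h0 h1
    have : t * (L + 1) < 1 := by rwa [lt_div_iff₀ (by positivity)] at h1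
    nlinarith
  have hbij : ∀ t : ℝ, 0 ≤ t → t < δ → Function.Injective (f t) ∧ Function.Surjective (f t) := by
    intro t h0 h1
    have happ : ApproximatesLinearOn (f t)
        ((ContinuousLinearEquiv.refl ℝ E : E ≃L[ℝ] E) : E →L[ℝ] E)
        Set.univ (t.toNNReal * L) := by
      intro x _ y _
      have : f t x - f t y - ((ContinuousLinearEquiv.refl ℝ E : E ≃L[ℝ] E) : E →L[ℝ] E) (x - y)
          = t • (Y x - Y y) := by
        simp [f, smul_sub]; abel
      rw [this, norm_smul, Real.norm_eq_abs, abs_of_nonneg h0]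
      have := hL.norm_sub_le x y
      calc t * ‖Y x - Y y‖ ≤ t * (L * ‖x - y‖) := by gcongr
        _ = _ := by push_cast; rw [Real.coe_toNNReal t h0, mul_assoc]
    have hc : Subsingleton E ∨ (t.toNNReal * L : NNReal) <
        ‖((ContinuousLinearEquiv.refl ℝ E).symm : E →L[ℝ] E)‖₊⁻¹ := by
      right
      have : ‖((ContinuousLinearEquiv.refl ℝ E).symm : E →L[ℝ] E)‖₊ = 1 := by
        ext
        exact ContinuousLinearMap.norm_id
      rw [this, inv_one, ← NNReal.coe_lt_coe]
      push_cast
      rw [Real.coe_toNNReal t h0]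
      exact hδL t h0 h1
    refine ⟨fun x y hxy => ?_, happ.surjective hc⟩
    have := @ApproximatesLinearOn.injective _ _ _ _ _ _ _ _ _ _ _ _ happ hc ⟨x, trivial⟩
      ⟨y, trivial⟩ hxy
    exact congrArg Subtype.val this
  have himg : ∀ t : ℝ, 0 ≤ t → t < δ → f t '' s = Metric.ball 0 (√(1 + t ^ 2)) \ {0} := by
    intro t h0 h1
    have hpos : 0 < √(1 + t ^ 2) := by positivity
    have key : ∀ x, x ∈ s ↔ f t x ∈ Metric.ball (0 : E) (√(1 + t ^ 2)) \ {0} := by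
      intro x
      simp only [s, Set.mem_sdiff, mem_ball_zero_iff, Set.mem_singleton_iff,
        ← norm_eq_zero (a := f t x),
        hfn, ← norm_eq_zero (a := x)]
      rw [mul_eq_zero, or_iff_right hpos.ne']
      constructor
      · rintro ⟨h, h'⟩; exact ⟨by nlinarith, h'⟩
      · rintro ⟨h, h'⟩; exact ⟨by by_contra hh; nlinarith, h'⟩
    ext y
    constructor
    · rintro ⟨x, hx, rfl⟩; exact (key x).1 hx
    · intro hy
      obtain ⟨x, rfl⟩ := (hbij t h0 h1).2 y
      exact ⟨x, (key x).2 hy, rfl⟩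
  have hvol : ∀ t : ℝ, 0 ≤ t → t < δ →
      μ.real (f t '' s) = √(1 + t ^ 2) ^ m * μ.real (Metric.ball 0 1) := by
    intro t h0 h1
    rw [himg t h0 h1, measureReal_def, measure_sdiff_null (measure_singleton 0)]
    have := Measure.addHaar_ball_mul μ (0 : E) (Real.sqrt_nonneg (1 + t ^ 2)) 1
    rw [mul_one] at this
    rw [this, ENNReal.toReal_mul, ENNReal.toReal_ofReal (by positivity), measureReal_def]
  have hfd : ∀ t : ℝ, ∀ x ∈ s, HasFDerivWithinAt (f t) (1 + t • fderiv ℝ Y x) s x := by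
    intro t x hx
    exact ((hasFDerivAt_id x).add ((hd x hx.2).hasFDerivAt.const_smul t)).hasFDerivWithinAt
  have hdet : ∀ t : ℝ, 0 ≤ t → t < δ → ∀ x, 0 < (1 + t • fderiv ℝ Y x).det := by
    intro t h0 h1 x
    apply det_one_add_pos
    rw [norm_smul, Real.norm_eq_abs, abs_of_nonneg h0]
    refine lt_of_le_of_lt ?_ (hδL t h0 h1)
    gcongr
    exact norm_fderiv_le_of_lipschitz ℝ hL
  have hinteg : ∀ t : ℝ, 0 ≤ t → t < δ →
      IntegrableOn (fun x => (1 + t • fderiv ℝ Y x).det) s μ := by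
    intro t h0 h1
    have := (integrableOn_image_iff_integrableOn_abs_det_fderiv_smul μ hs (hfd t)
      (hbij t h0 h1).1.injOn (fun _ => (1 : ℝ))).1 (by
        rw [himg t h0 h1]
        refine integrableOn_const (ne_of_lt ?_)
        exact lt_of_le_of_lt (measure_mono Set.sdiff_subset) measure_ball_lt_top)
    refine this.congr_fun (fun x _ => ?_) hs
    simp [abs_of_pos (hdet t h0 h1 x)]
  have hval : ∀ t : ℝ, 0 ≤ t → t < δ → ∫ x in s, (1 + t • fderiv ℝ Y x).det ∂μ =
      √(1 + t ^ 2) ^ m * μ.real (Metric.ball 0 1) := by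
    intro t h0 h1
    have := integral_image_eq_integral_abs_det_fderiv_smul μ hs (hfd t)
      (hbij t h0 h1).1.injOn (fun _ => (1 : ℝ))
    rw [← hvol t h0 h1]
    simp only [smul_eq_mul, mul_one, integral_const, measureReal_restrict_apply_univ] at this
    rw [this]
    refine setIntegral_congr_fun hs fun x _ => ?_
    exact (abs_of_pos (hdet t h0 h1 x)).symm
  let node : ℕ → ℝ := fun i => δ * (i / (m + 1))
  have hnode : ∀ i ∈ Finset.range (m + 1), 0 ≤ node i ∧ node i < δ := by
    intro i hi
    have hi' : (i : ℝ) < m + 1 := by exact_mod_cast Finset.mem_range.1 hi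
    refine ⟨by positivity, ?_⟩
    have : (i : ℝ) / (m + 1) < 1 := (div_lt_one (by positivity)).2 hi'
    simp only [node]
    nlinarith
  have hinj : Set.InjOn node (Finset.range (m + 1)) := by
    intro i _ j _ hij
    simp only [node] at hij
    have := mul_left_cancel₀ hδ.ne' hij
    rw [div_left_inj' (by positivity)] at this
    exact_mod_cast this
  let P : ℝ[X] := ∑ i ∈ Finset.range (m + 1),
    C (√(1 + node i ^ 2) ^ m * μ.real (Metric.ball 0 1)) *
      Lagrange.basis (Finset.range (m + 1)) node i
  have hP : ∀ t : ℝ, 0 ≤ t → t < δ →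
      P.eval t = √(1 + t ^ 2) ^ m * μ.real (Metric.ball 0 1) := by
    intro t h0 h1
    rw [← hval t h0 h1]
    have hpt : ∀ x, (1 + t • fderiv ℝ Y x).det = ∑ i ∈ Finset.range (m + 1),
        (1 + node i • fderiv ℝ Y x).det *
          (Lagrange.basis (Finset.range (m + 1)) node i).eval t := by
      intro x
      obtain ⟨p, hp, hpe⟩ := exists_polynomial_eval_eq_det_one_add_smul (fderiv ℝ Y x)
      have := Lagrange.eq_interpolate hinj (by rwa [Finset.card_range])
      rw [← hpe, this, Lagrange.interpolate_apply, eval_finsetSum]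
      simp only [eval_mul, eval_C, hpe]
    simp only [hpt]
    rw [integral_finsetSum _ fun i hi =>
      (hinteg _ (hnode i hi).1 (hnode i hi).2).mul_const _]
    simp only [P, eval_finsetSum, eval_mul, eval_C]
    refine Finset.sum_congr rfl fun i hi => ?_
    rw [integral_mul_const, hval _ (hnode i hi).1 (hnode i hi).2]
  have hv : μ.real (Metric.ball (0 : E) 1) ≠ 0 :=
    (ENNReal.toReal_pos (Metric.measure_ball_pos μ _ one_pos).ne' measure_ball_lt_top.ne).ne'
  obtain ⟨k, hk⟩ := hodd
  refine sq_ne_one_add_sq_pow (C (μ.real (Metric.ball (0 : E) 1))⁻¹ * P) k ?_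
  refine eq_of_infinite_eval_eq _ _ ((Set.Ico_infinite hδ).mono ?_)
  rintro t ⟨h0, h1⟩
  have hsq : √(1 + t ^ 2) ^ 2 = 1 + t ^ 2 := Real.sq_sqrt (by positivity)
  simp only [Set.mem_ofPred_eq, eval_pow, eval_mul, eval_C, hP t h0 h1, eval_add, eval_one, eval_X]
  rw [← hk]
  nth_rewrite 2 [← hsq]
  rw [← pow_mul, mul_comm 2, pow_mul]
  congr 1
  field_simp

/-- The degree-one homogeneous extension of a Lipschitz unit field on the sphere is Lipschitz. -/
lemma exists_lipschitzWith_norm_smul {E : Type*} [NormedAddCommGroup E] [NormedSpace ℝ E]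
    (u : E → E) (K : NNReal) (hK : LipschitzOnWith K u (Metric.sphere 0 1))
    (hu : ∀ x ∈ Metric.sphere (0 : E) 1, ‖u x‖ = 1) :
    LipschitzWith (1 + 2 * K) fun x => ‖x‖ • u (‖x‖⁻¹ • x) := by
  have hmem : ∀ x : E, x ≠ 0 → ‖x‖⁻¹ • x ∈ Metric.sphere (0 : E) 1 := by
    intro x hx
    simp [norm_smul, norm_ne_zero_iff.2 hx]
  refine LipschitzWith.of_dist_le_mul fun x y => ?_
  rw [dist_eq_norm, dist_eq_norm]
  push_cast
  have hK0 : (0 : ℝ) ≤ K := K.2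
  by_cases hx : x = 0
  · by_cases hy : y = 0
    · simp [hx, hy]
    · have := hu _ (hmem y hy)
      simp only [hx, norm_zero, zero_smul, zero_sub, norm_neg, norm_smul, norm_norm, this]
      nlinarith [norm_nonneg y]
  by_cases hy : y = 0
  · have := hu _ (hmem x hx)
    simp only [hy, norm_zero, zero_smul, sub_zero, norm_smul, norm_norm, this]
    nlinarith [norm_nonneg x]
  have hx' : 0 < ‖x‖ := norm_pos_iff.2 hx
  have hy' : 0 < ‖y‖ := norm_pos_iff.2 hy
  set a := ‖x‖⁻¹ • x with ha
  set b := ‖y‖⁻¹ • y with hb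
  have h1 : ‖u a - u b‖ ≤ K * ‖a - b‖ := hK.norm_sub_le (hmem x hx) (hmem y hy)
  have hxa : x = ‖x‖ • a := by rw [ha, smul_smul, mul_inv_cancel₀ hx'.ne', one_smul]
  have hyb : y = ‖y‖ • b := by rw [hb, smul_smul, mul_inv_cancel₀ hy'.ne', one_smul]
  have han : ‖a‖ = 1 := by simpa using hmem x hx
  have habs : |‖x‖ - ‖y‖| ≤ ‖x - y‖ := abs_norm_sub_norm_le x y
  have h2 : ‖y‖ * ‖a - b‖ ≤ 2 * ‖x - y‖ := by
    have : ‖y‖ • (a - b) = (x - y) - (‖x‖ - ‖y‖) • a := by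
      rw [sub_smul, ← hxa, smul_sub, ← hyb]; abel
    calc ‖y‖ * ‖a - b‖ = ‖‖y‖ • (a - b)‖ := by rw [norm_smul, norm_norm]
      _ ≤ ‖x - y‖ + ‖(‖x‖ - ‖y‖) • a‖ := by rw [this]; exact norm_sub_le _ _
      _ ≤ ‖x - y‖ + ‖x - y‖ := by rw [norm_smul, han, mul_one]; gcongr; exact habs
      _ = 2 * ‖x - y‖ := by ring
  have h3 : ‖x‖ • u a - ‖y‖ • u b = (‖x‖ - ‖y‖) • u a + ‖y‖ • (u a - u b) := by
    rw [sub_smul, smul_sub]; abel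
  calc ‖‖x‖ • u a - ‖y‖ • u b‖ ≤ ‖(‖x‖ - ‖y‖) • u a‖ + ‖‖y‖ • (u a - u b)‖ := by
        rw [h3]; exact norm_add_le _ _
    _ = |‖x‖ - ‖y‖| + ‖y‖ * ‖u a - u b‖ := by
        rw [norm_smul, norm_smul, hu a (hmem x hx), mul_one, norm_norm, Real.norm_eq_abs]
    _ ≤ ‖x - y‖ + K * (2 * ‖x - y‖) := by
        refine add_le_add habs ?_
        calc ‖y‖ * ‖u a - u b‖ ≤ ‖y‖ * (K * ‖a - b‖) := by gcongr
          _ = K * (‖y‖ * ‖a - b‖) := by ring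
          _ ≤ _ := by gcongr
    _ = (1 + 2 * K) * ‖x - y‖ := by ring

/-- The hairy ball theorem, for spheres in Euclidean spaces of odd dimension. -/
theorem hairy_ball {E : Type*} [NormedAddCommGroup E]
    [InnerProductSpace ℝ E] [FiniteDimensional ℝ E] (hodd : Odd (Module.finrank ℝ E))
    (Y : E → E) (hY : ContinuousOn Y (Metric.sphere 0 1))
    (ht : ∀ x ∈ Metric.sphere (0 : E) 1, inner ℝ x (Y x) = 0) :
    ∃ x ∈ Metric.sphere (0 : E) 1, Y x = 0 := by
  by_contra! hne
  have : Nontrivial E := Module.nontrivial_of_finrank_pos (R := ℝ) hodd.pos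
  have hcomp : IsCompact (Metric.sphere (0 : E) 1) := isCompact_sphere 0 1
  obtain ⟨x₀, hx₀, hmin⟩ := hcomp.exists_isMinOn (NormedSpace.sphere_nonempty.2 zero_le_one) hY.norm
  obtain ⟨G, hG⟩ := ContinuousMap.exists_restrict_eq
    (Metric.isClosed_sphere (x := (0 : E)) (ε := 1))
    ⟨_, continuousOn_iff_continuous_domRestrict.1 hY⟩
  have hGY : ∀ x ∈ Metric.sphere (0 : E) 1, G x = Y x := fun x hx =>
    congrArg (fun F => F ⟨x, hx⟩) hG
  obtain ⟨h, hsm, hclose, -⟩ := G.continuous.exists_contDiff_approx 1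
    (continuous_const (y := ‖Y x₀‖)) fun _ => norm_pos_iff.2 (hne x₀ hx₀)
  let k : E → E := fun x => h x - inner ℝ x (h x) • x
  have hk : ContDiff ℝ 1 k := hsm.sub ((contDiff_id.inner ℝ hsm).smul contDiff_id)
  have hk0 : ∀ x ∈ Metric.sphere (0 : E) 1, k x ≠ 0 := by
    intro x hx h0
    have hhx : h x = inner ℝ x (h x) • x := sub_eq_zero.1 h0
    have horth : inner ℝ (Y x) (h x) = 0 := by
      rw [hhx, inner_smul_right, real_inner_comm x, ht x hx, mul_zero]
    have h1 : ‖h x - Y x‖ < ‖Y x₀‖ := by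
      rw [← hGY x hx, ← dist_eq_norm]; exact hclose x
    have h2 : ‖Y x₀‖ ≤ ‖Y x‖ := hmin hx
    have h3 : ‖h x - Y x‖ ^ 2 = ‖h x‖ ^ 2 + ‖Y x‖ ^ 2 := by
      rw [norm_sub_sq_real, real_inner_comm, horth]; ring
    nlinarith [norm_nonneg (h x), norm_nonneg (h x - Y x), norm_nonneg (Y x)]
  have hkt : ∀ x ∈ Metric.sphere (0 : E) 1, inner ℝ x (k x) = 0 := by
    intro x hx
    have : ‖x‖ = 1 := by simpa using hx
    simp only [k]
    rw [inner_sub_right, inner_smul_right, real_inner_self_eq_norm_sq, this]; ring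
  let u : E → E := fun x => ‖k x‖⁻¹ • k x
  have hu1 : ∀ x ∈ Metric.sphere (0 : E) 1, ‖u x‖ = 1 := by
    intro x hx
    simp [u, norm_smul, norm_ne_zero_iff.2 (hk0 x hx)]
  have hud : ∀ x ∈ Metric.sphere (0 : E) 1, ContDiffAt ℝ 1 u x := by
    intro x hx
    exact ((hk.contDiffAt.norm ℝ (hk0 x hx)).inv (norm_ne_zero_iff.2 (hk0 x hx))).smul
      hk.contDiffAt
  obtain ⟨K, hK⟩ := LocallyLipschitzOn.exists_lipschitzOnWith_of_compact hcomp (f := u) (by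
    intro x hx
    obtain ⟨K, t, ht, hKt⟩ := (hud x hx).exists_lipschitzOnWith
    exact ⟨K, t, mem_nhdsWithin_of_mem_nhds ht, hKt⟩)
  have hmem : ∀ x : E, x ≠ 0 → ‖x‖⁻¹ • x ∈ Metric.sphere (0 : E) 1 := by
    intro x hx
    simp [norm_smul, norm_ne_zero_iff.2 hx]
  refine no_lipschitz_unit_tangent_field hodd _ _ (exists_lipschitzWith_norm_smul u K hK hu1)
    ?_ ?_ ?_
  · intro x hx
    have hnd : DifferentiableAt ℝ (fun x : E => ‖x‖) x := differentiableAt_id.norm ℝ hx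
    have hin : DifferentiableAt ℝ (fun x : E => ‖x‖⁻¹ • x) x :=
      (hnd.inv (norm_ne_zero_iff.2 hx)).smul differentiableAt_id
    exact hnd.smul (DifferentiableAt.comp (f := fun x : E => ‖x‖⁻¹ • x) x
      ((hud _ (hmem x hx)).differentiableAt one_ne_zero) hin)
  · intro x
    by_cases hx : x = 0
    · simp [hx]
    · rw [norm_smul, hu1 _ (hmem x hx), norm_norm, mul_one]
  · intro x
    by_cases hx : x = 0
    · simp [hx]
    · have h1 := hkt _ (hmem x hx)
      rw [inner_smul_left] at h1
      have h2 : inner ℝ x (k (‖x‖⁻¹ • x)) = 0 := by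
        simpa [norm_ne_zero_iff.2 hx, hx] using h1
      simp only [u]
      rw [inner_smul_right, inner_smul_right, h2, mul_zero, mul_zero]

/-- Along a compact family of paths, small steps stay in a given neighbourhood of the diagonal. -/
lemma exists_nat_steps_mem {S Y : Type*} [TopologicalSpace S] [CompactSpace S]
    [TopologicalSpace Y] (γ : S × ℝ → Y) (hγ : Continuous γ) (U : Set (Y × Y)) (hU : IsOpen U)
    (hdiag : ∀ y, (y, y) ∈ U) :
    ∃ N : ℕ, 0 < N ∧ ∀ x, ∀ i : ℕ, i < N →
      (γ (x, ((i + 1 : ℕ) : ℝ) / N), γ (x, (i : ℝ) / N)) ∈ U := by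
  let K : Set (S × ℝ × ℝ) := (Set.univ ×ˢ Set.Icc 0 1 ×ˢ Set.Icc 0 1) ∩
    (fun q => (γ (q.1, q.2.1), γ (q.1, q.2.2))) ⁻¹' Uᶜ
  have hK : IsCompact K :=
    (isCompact_univ.prod (isCompact_Icc.prod isCompact_Icc)).inter_right
      (hU.isClosed_compl.preimage (by fun_prop))
  obtain ⟨δ, hδ, hδK⟩ : ∃ δ : ℝ, 0 < δ ∧ ∀ q ∈ K, δ ≤ |q.2.1 - q.2.2| := by
    rcases K.eq_empty_or_nonempty with h | h
    · exact ⟨1, one_pos, by simp [h]⟩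
    · obtain ⟨q, hq, hmin⟩ := hK.exists_isMinOn h
        (f := fun q : S × ℝ × ℝ => |q.2.1 - q.2.2|) (by fun_prop)
      refine ⟨_, abs_pos.2 fun h0 => hq.2 ?_, fun q' hq' => hmin hq'⟩
      rw [sub_eq_zero] at h0
      change (γ (q.1, q.2.1), γ (q.1, q.2.2)) ∈ U
      rw [h0]
      exact hdiag _
  obtain ⟨N, hN⟩ := exists_nat_gt (1 / δ)
  have hN0 : (0 : ℝ) < N := lt_trans (by positivity) hN
  refine ⟨N, by exact_mod_cast hN0, fun x i hi => ?_⟩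
  by_contra hnot
  have hi' : (i : ℝ) + 1 ≤ N := by exact_mod_cast hi
  have := hδK (x, ((i + 1 : ℕ) : ℝ) / N, (i : ℝ) / N)
    ⟨⟨trivial, ⟨by positivity, (div_le_one hN0).2 (by push_cast; exact hi')⟩,
      ⟨by positivity, (div_le_one hN0).2 (by linarith)⟩⟩, hnot⟩
  simp only at this
  rw [← sub_div, abs_div, abs_of_pos hN0] at this
  push_cast at this
  rw [add_sub_cancel_left, abs_one, le_div_iff₀ hN0] at this
  rw [div_lt_iff₀ hδ] at hN
  linarith

/-- A nonzero vector in the image of a projection extends, along a compact family of paths, to a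
nowhere vanishing section of the images of a continuous family of projections. -/
lemma exists_section_of_projections {ι S : Type*} [Fintype ι] [DecidableEq ι] [TopologicalSpace S]
    [CompactSpace S] {Y : Type*} [TopologicalSpace Y] (P : Y → Matrix ι ι ℝ) (hP : Continuous P)
    (hPP : ∀ v, P v * P v = P v) (γ : S × ℝ → Y) (hγ : Continuous γ) (p : Y)
    (h0 : ∀ x, γ (x, 0) = p) (hp : P p ≠ 0) :
    ∃ s : S → ι → ℝ, Continuous s ∧ ∀ x, s x ≠ 0 ∧ P (γ (x, 1)) *ᵥ s x = s x := by
  obtain ⟨N, hN, hstep⟩ := exists_nat_steps_mem γ hγ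
    {q | (P q.1 * P q.2 + (1 - P q.1) * (1 - P q.2)).det ≠ 0}
    (isOpen_ne.preimage (f := fun q : Y × Y => (P q.1 * P q.2 + (1 - P q.1) * (1 - P q.2)).det)
      (by fun_prop)) (by
      intro y
      have : P y * P y + (1 - P y) * (1 - P y) = 1 := by
        simp only [sub_mul, mul_sub, one_mul, mul_one, hPP]; abel
      simp [this])
  have main : ∀ i : ℕ, i ≤ N → ∃ s : S → ι → ℝ, Continuous s ∧
      ∀ x, s x ≠ 0 ∧ P (γ (x, (i : ℝ) / N)) *ᵥ s x = s x := by
    intro i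
    induction i with
    | zero =>
      intro _
      obtain ⟨e, he⟩ : ∃ e, P p *ᵥ e ≠ 0 := by
        by_contra! h
        exact hp (Matrix.ext_iff_mulVec.2 fun v => by rw [h, zero_mulVec])
      refine ⟨fun _ => P p *ᵥ e, continuous_const, fun x => ⟨he, ?_⟩⟩
      simp [h0, hPP]
    | succ i ih =>
      intro hi
      obtain ⟨s, hs, hs'⟩ := ih (by omega)
      refine ⟨fun x => P (γ (x, ((i + 1 : ℕ) : ℝ) / N)) *ᵥ s x, by fun_prop, fun x => ⟨?_, ?_⟩⟩
      · intro hz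
        refine (hs' x).1 (eq_zero_of_mulVec_eq_zero (hstep x i hi) ?_)
        have hc : (1 - P (γ (x, (i : ℝ) / N))) *ᵥ s x = 0 := by
          rw [sub_mulVec, one_mulVec, (hs' x).2, sub_self]
        change (P (γ (x, ((i + 1 : ℕ) : ℝ) / N)) * P (γ (x, (i : ℝ) / N)) +
          (1 - P (γ (x, ((i + 1 : ℕ) : ℝ) / N))) * (1 - P (γ (x, (i : ℝ) / N)))) *ᵥ s x = 0
        rw [add_mulVec, ← mulVec_mulVec, ← mulVec_mulVec, (hs' x).2, hc, mulVec_zero, add_zero]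
        exact hz
      · rw [mulVec_mulVec, hPP]
  obtain ⟨s, hs, hs'⟩ := main N le_rfl
  refine ⟨s, hs, fun x => ?_⟩
  have : (N : ℝ) / N = 1 := div_self (by positivity)
  simpa only [this] using hs' x

/-- A path family contracting the half sphere around `p` to `p` within the nonzero vectors. -/
lemma exists_contraction_of_half_sphere {ι : Type*} [Fintype ι] (p : {v : ι → ℝ // v ≠ 0}) :
    ∃ γ : Metric.sphere (0 : EuclideanSpace ℝ ι) 1 × ℝ → {v : ι → ℝ // v ≠ 0}, Continuous γ ∧
      (∀ x, γ (x, 0) = p) ∧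
      ∀ x : Metric.sphere (0 : EuclideanSpace ℝ ι) 1, 0 ≤ x.1.ofLp ⬝ᵥ p →
        (γ (x, 1) : ι → ℝ) = x.1.ofLp := by
  have hpp : 0 < (p : ι → ℝ) ⬝ᵥ p := by
    refine lt_of_le_of_ne ?_ fun h => p.2 (dotProduct_self_eq_zero.1 h.symm)
    exact Finset.sum_nonneg fun i _ => mul_self_nonneg _
  let c : ℝ := 2 / ((p : ι → ℝ) ⬝ᵥ p)
  let fold : Metric.sphere (0 : EuclideanSpace ℝ ι) 1 → ι → ℝ := fun x =>
    x.1.ofLp + (max 0 (-(x.1.ofLp ⬝ᵥ p)) * c) • (p : ι → ℝ)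
  have hfold_eq : ∀ x : Metric.sphere (0 : EuclideanSpace ℝ ι) 1, 0 ≤ x.1.ofLp ⬝ᵥ p →
      fold x = x.1.ofLp := by
    intro x hx
    simp [fold, max_eq_left (neg_nonpos.2 hx)]
  have hdot : ∀ x, fold x ⬝ᵥ p = x.1.ofLp ⬝ᵥ p + 2 * max 0 (-(x.1.ofLp ⬝ᵥ p)) := by
    intro x
    simp only [fold, add_dotProduct, smul_dotProduct, smul_eq_mul, c]
    field_simp
  have hfold : ∀ x, 0 ≤ fold x ⬝ᵥ p ∧ fold x ≠ 0 := by
    intro x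
    rcases le_or_gt 0 (x.1.ofLp ⬝ᵥ p) with h | h
    · rw [hfold_eq x h]
      refine ⟨h, fun h0 => ?_⟩
      have h1 : x.1 = 0 := by ext i; exact congrFun h0 i
      have := x.2
      simp [h1] at this
    · have h2 : 0 < fold x ⬝ᵥ p := by
        rw [hdot, max_eq_right (by linarith)]; linarith
      exact ⟨h2.le, fun h0 => by simp [h0] at h2⟩
  let τ : ℝ → ℝ := fun t => max 0 (min 1 t)
  have hcont : Continuous fun q : Metric.sphere (0 : EuclideanSpace ℝ ι) 1 × ℝ =>
      (1 - τ q.2) • (p : ι → ℝ) + τ q.2 • fold q.1 := by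
    have h1 : Continuous fun x : Metric.sphere (0 : EuclideanSpace ℝ ι) 1 => x.1.ofLp :=
      (PiLp.continuous_ofLp 2 _).comp continuous_subtype_val
    have h2 : Continuous fun x : Metric.sphere (0 : EuclideanSpace ℝ ι) 1 =>
        x.1.ofLp ⬝ᵥ (p : ι → ℝ) := h1.dotProduct continuous_const
    have h3 : Continuous fold := by fun_prop
    have h4 : Continuous τ := by fun_prop
    fun_prop
  have hne : ∀ q : Metric.sphere (0 : EuclideanSpace ℝ ι) 1 × ℝ,
      (1 - τ q.2) • (p : ι → ℝ) + τ q.2 • fold q.1 ≠ 0 := by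
    intro q h0
    have hτ0 : 0 ≤ τ q.2 := le_max_left _ _
    have hτ1 : τ q.2 ≤ 1 := max_le zero_le_one (min_le_left _ _)
    have h1 := congrArg (fun w : ι → ℝ => w ⬝ᵥ p) h0
    simp only [add_dotProduct, smul_dotProduct, smul_eq_mul, zero_dotProduct] at h1
    have h2 := mul_nonneg hτ0 (hfold q.1).1
    have h3 : τ q.2 = 1 := by
      by_contra hne
      have := mul_pos (sub_pos.2 (lt_of_le_of_ne hτ1 hne)) hpp
      linarith
    rw [h3] at h0
    exact (hfold q.1).2 (by simpa using h0)
  refine ⟨fun q => ⟨_, hne q⟩, hcont.subtype_mk hne, fun x => ?_, fun x hx => ?_⟩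
  · apply Subtype.ext
    simp [τ]
  · simp [τ, hfold_eq x hx]

/-- The tangent bundle of an even-dimensional sphere has no proper subbundles: there are no
continuous families of projections `P v`, `F v` with `P v * F v = 0`, both killing `v`, and with
nonzero values at a point and at its antipode respectively. -/
theorem no_complementary_projections {ι : Type*} [Fintype ι] [DecidableEq ι]
    (hodd : Odd (Fintype.card ι)) (P F : {v : ι → ℝ // v ≠ 0} → Matrix ι ι ℝ)
    (hP : Continuous P) (hF : Continuous F) (hPP : ∀ v, P v * P v = P v)
    (hFF : ∀ v, F v * F v = F v) (hPF : ∀ v, P v * F v = 0)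
    (hPv : ∀ v, P v *ᵥ (v : ι → ℝ) = 0) (hFv : ∀ v, F v *ᵥ (v : ι → ℝ) = 0)
    (p p' : {v : ι → ℝ // v ≠ 0}) (hneg : (p' : ι → ℝ) = -p) (hp : P p ≠ 0) (hp' : F p' ≠ 0) :
    False := by
  obtain ⟨γ, hγ, hγ0, hγ1⟩ := exists_contraction_of_half_sphere p
  obtain ⟨γ', hγ', hγ0', hγ1'⟩ := exists_contraction_of_half_sphere p'
  obtain ⟨s, hs, hs'⟩ := exists_section_of_projections P hP hPP γ hγ p hγ0 hp
  obtain ⟨t, ht, ht'⟩ := exists_section_of_projections F hF hFF γ' hγ' p' hγ0' hp'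
  have hne : ∀ x : Metric.sphere (0 : EuclideanSpace ℝ ι) 1, x.1.ofLp ≠ 0 := by
    intro x h0
    have h1 : x.1 = 0 := by ext i; exact congrFun h0 i
    have := x.2
    simp [h1] at this
  let b : Metric.sphere (0 : EuclideanSpace ℝ ι) 1 → {v : ι → ℝ // v ≠ 0} :=
    fun x => ⟨x.1.ofLp, hne x⟩
  have hb : Continuous b :=
    ((PiLp.continuous_ofLp 2 _).comp continuous_subtype_val).subtype_mk hne
  let z : Metric.sphere (0 : EuclideanSpace ℝ ι) 1 → EuclideanSpace ℝ ι := fun x =>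
    WithLp.toLp 2 (P (b x) *ᵥ s x + F (b x) *ᵥ t x)
  have hz : Continuous z := (PiLp.continuous_toLp 2 _).comp (by fun_prop)
  classical
  let Y : EuclideanSpace ℝ ι → EuclideanSpace ℝ ι := fun x =>
    if hx : x ∈ Metric.sphere 0 1 then z ⟨x, hx⟩ - inner ℝ x (z ⟨x, hx⟩) • x else 0
  have hY : ∀ x : Metric.sphere (0 : EuclideanSpace ℝ ι) 1,
      Y x = z x - inner ℝ x.1 (z x) • x.1 := fun x => dif_pos x.2
  obtain ⟨x, hx, hx0⟩ := hairy_ball (E := EuclideanSpace ℝ ι) (by simpa using hodd) Y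
    (by
      rw [continuousOn_iff_continuous_domRestrict]
      refine Continuous.congr (f := fun x => z x - inner ℝ x.1 (z x) • x.1) ?_
        fun x => (hY x).symm
      fun_prop)
    (by
      intro x hx
      have h1 : ‖x‖ = 1 := by simpa using hx
      rw [hY ⟨x, hx⟩, inner_sub_right, inner_smul_right, real_inner_self_eq_norm_sq, h1]
      simp)
  rw [hY ⟨x, hx⟩, sub_eq_zero] at hx0
  set y : Metric.sphere (0 : EuclideanSpace ℝ ι) 1 := ⟨x, hx⟩
  have key : P (b y) *ᵥ s y + F (b y) *ᵥ t y = (inner ℝ x (z y) : ℝ) • (b y : ι → ℝ) :=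
    congrArg WithLp.ofLp hx0
  have hPs : P (b y) *ᵥ s y = 0 := by
    have := congrArg (P (b y) *ᵥ ·) key
    simpa [mulVec_add, mulVec_mulVec, hPP, hPF, mulVec_smul, hPv] using this
  have hFt : F (b y) *ᵥ t y = 0 := by
    have := congrArg (F (b y) *ᵥ ·) key
    simpa [mulVec_add, hPs, mulVec_mulVec, hFF, mulVec_smul, hFv] using this
  rcases le_total 0 (y.1.ofLp ⬝ᵥ p) with h | h
  · have h1 := (hs' y).2
    rw [show γ (y, 1) = b y from Subtype.ext (hγ1 y h), hPs] at h1
    exact (hs' y).1 h1.symm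
  · have h1 := (ht' y).2
    rw [show γ' (y, 1) = b y from Subtype.ext (hγ1' y (by rw [hneg, dotProduct_neg]; linarith)),
      hFt] at h1
    exact (ht' y).1 h1.symm

/-- A real matrix which commutes with `I` and fixes the image of `1 + I * I`, where
`I * I * I = -I`, has nonnegative determinant. -/
lemma det_nonneg_of_commute {ι : Type*} [Fintype ι] [DecidableEq ι] (A I : Matrix ι ι ℝ)
    (hI : I * I * I = -I) (hA : A * (1 + I * I) = 1 + I * I) (hAI : A * I = I * A) :
    0 ≤ A.det := by
  let φ : Matrix ι ι ℝ →+* Matrix ι ι ℂ := Complex.ofRealHom.mapMatrix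
  let σ : Matrix ι ι ℂ →+* Matrix ι ι ℂ := (starRingEnd ℂ).mapMatrix
  have hσφ : ∀ M, σ (φ M) = φ M := by
    intro M
    ext i j
    exact Complex.conj_ofReal _
  have hσs : ∀ (c : ℂ) M, σ (c • M) = (starRingEnd ℂ) c • σ M := by
    intro c M
    ext i j
    exact map_mul (starRingEnd ℂ) _ _
  let a := φ A
  let j := φ I
  have hj : j * j * j = -j := by rw [← map_mul, ← map_mul, hI, map_neg]
  have ha : a * (j * j) = 1 + j * j - a := by
    have h1 : a * (1 + j * j) = 1 + j * j := by
      have := congrArg φ hA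
      simpa only [map_mul, map_add, map_one] using this
    rw [mul_add, mul_one] at h1
    rw [← h1]; abel
  have haj : a * j = j * a := by rw [← map_mul, hAI, map_mul]
  let q : Matrix ι ι ℂ := (2⁻¹ : ℂ) • (-(j * j) - Complex.I • j)
  let q' : Matrix ι ι ℂ := (2⁻¹ : ℂ) • (-(j * j) + Complex.I • j)
  have hqq : q * q' = 0 := by
    have : (-(j * j) - Complex.I • j) * (-(j * j) + Complex.I • j) = 0 := by
      simp only [sub_mul, mul_add, neg_mul, mul_neg, smul_mul_assoc, mul_smul_comm, ← mul_assoc, hj]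
      simp only [smul_sub, smul_neg, neg_neg, smul_smul, Complex.I_mul_I, neg_one_smul]
      abel
    simp only [q, q', smul_mul_assoc, mul_smul_comm, this, smul_zero]
  have hsum : q + q' = -(j * j) := by
    rw [← smul_add]
    have : -(j * j) - Complex.I • j + (-(j * j) + Complex.I • j) = (2 : ℂ) • (-(j * j)) := by
      rw [two_smul]; abel
    rw [this, smul_smul]; norm_num
  have haq : a * q' = q' * a := by
    simp only [q', smul_mul_assoc, mul_smul_comm, mul_add, add_mul, mul_neg, neg_mul, mul_assoc]
    rw [← haj, ← mul_assoc j a j, ← haj, ← mul_assoc a j j]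
  have haq2 : a * q = q * a := by
    simp only [q, smul_mul_assoc, mul_smul_comm, mul_sub, sub_mul, mul_neg, neg_mul, mul_assoc]
    rw [← haj, ← mul_assoc j a j, ← haj, ← mul_assoc a j j]
  let B := a * q + (1 - q)
  have hB : σ B = a * q' + (1 - q') := by
    have : σ q = q' := by
      simp only [q, q', hσs, map_sub, map_neg, map_mul, j, hσφ, map_inv₀, map_ofNat, Complex.conj_I]
      simp
    simp only [B, map_add, map_mul, map_sub, map_one, this, a, hσφ]
  have hprod : B * σ B = a := by
    rw [hB]
    have h1 : a * q * (a * q') = 0 := by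
      rw [mul_assoc, haq, ← mul_assoc q, hqq, zero_mul, mul_zero]
    have h2 : q * (a * q') = 0 := by rw [haq, ← mul_assoc, hqq, zero_mul]
    have h3 : a * q * q' = 0 := by rw [mul_assoc, hqq, mul_zero]
    have h4 : B * (a * q' + (1 - q')) = a * (q + q') + 1 - (q + q') := by
      simp only [B, add_mul, mul_add, sub_mul, mul_sub, one_mul, mul_one, h1, h2, h3, hqq]
      abel
    rw [h4, hsum, mul_neg, ha]
    abel
  have hdet : ((A.det : ℝ) : ℂ) = B.det * (starRingEnd ℂ) B.det := by
    rw [RingHom.map_det, ← det_mul]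
    change _ = (B * σ B).det
    rw [hprod]
    exact RingHom.map_det Complex.ofRealHom A
  rw [Complex.mul_conj] at hdet
  rw [Complex.ofReal_injective hdet]
  exact Complex.normSq_nonneg _

/-- A continuous family of complex structures on complements of the lines `ℝ v` cannot take equal
values at a point and its antipode. -/
theorem no_even_complex_structure {ι : Type*} [Fintype ι] [DecidableEq ι] [Nontrivial ι]
    (I : {v : ι → ℝ // v ≠ 0} → Matrix ι ι ℝ) (l : {v : ι → ℝ // v ≠ 0} → ι → ℝ)
    (hI : Continuous I) (hl : Continuous l) (hlv : ∀ v, l v ⬝ᵥ v = 1)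
    (hII : ∀ v, I v * I v = vecMulVec v (l v) - 1) (hIv : ∀ v, I v *ᵥ v = 0)
    (hlI : ∀ v, l v ᵥ* I v = 0)
    (p p' : {v : ι → ℝ // v ≠ 0}) (hneg : (p' : ι → ℝ) = -p) (hI' : I p' = I p) : False := by
  let Q : {v : ι → ℝ // v ≠ 0} → Matrix ι ι ℝ := fun v => 1 - vecMulVec v (l v)
  have hQ : Continuous Q := by fun_prop
  have hIIQ : ∀ v, I v * I v = -Q v := fun v => by rw [hII, neg_sub]
  have hQI : ∀ v, Q v * I v = I v := fun v => by
    simp only [Q, sub_mul, one_mul, vecMulVec_mul, hlI, vecMulVec_zero, sub_zero]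
  have hIQ : ∀ v, I v * Q v = I v := fun v => by
    simp only [Q, mul_sub, mul_one, mul_vecMulVec, hIv, zero_vecMulVec, sub_zero]
  have hQQ : ∀ v, Q v * Q v = Q v := fun v => by
    rw [← neg_inj, ← mul_neg, ← hIIQ, ← mul_assoc, hQI]
  have hQv : ∀ v, Q v *ᵥ (v : ι → ℝ) = 0 := fun v => by
    simp [Q, sub_mulVec, vecMulVec_mulVec, hlv]
  let T : {v : ι → ℝ // v ≠ 0} × {v : ι → ℝ // v ≠ 0} → Matrix ι ι ℝ := fun q =>
    (2⁻¹ : ℝ) • (Q q.1 * Q q.2 - I q.1 * I q.2) + vecMulVec q.1 (l q.2)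
  have hT : Continuous T := by fun_prop
  have hTd : ∀ v, T (v, v) = 1 := by
    intro v
    simp only [T, hQQ, hIIQ, sub_neg_eq_add]
    rw [← two_smul ℝ, smul_smul]
    simp [Q]
  have hTv : ∀ w v, T (w, v) *ᵥ (v : ι → ℝ) = w := by
    intro w v
    simp [T, add_mulVec, smul_mulVec, sub_mulVec, ← mulVec_mulVec, hQv, hIv, vecMulVec_mulVec, hlv]
  have hTI : ∀ w v, T (w, v) * I v = I w * T (w, v) := by
    intro w v
    simp only [T, add_mul, mul_add, smul_mul_assoc, mul_smul_comm, vecMulVec_mul, hlI,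
      mul_vecMulVec, hIv, zero_vecMulVec, vecMulVec_zero, add_zero, sub_mul, mul_sub]
    rw [mul_assoc, hQI, mul_assoc, hIIQ, ← mul_assoc, hIQ, ← mul_assoc (I w), hIIQ]
    rw [mul_neg, neg_mul, sub_neg_eq_add, sub_neg_eq_add, add_comm]
  obtain ⟨i, hi⟩ := Function.ne_iff.1 p.2
  obtain ⟨j, hij⟩ := exists_ne i
  let e : ι → ℝ := Pi.single j ((p : ι → ℝ) i) - Pi.single i ((p : ι → ℝ) j)
  have he : e ≠ 0 := Function.ne_iff.2 ⟨j, by simpa [e, hij] using hi⟩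
  have hep : e ⬝ᵥ p = 0 := by simp [e, sub_dotProduct, mul_comm]
  have hγne : ∀ t : ℝ, Real.cos t • (p : ι → ℝ) + Real.sin t • e ≠ 0 := by
    intro t h0
    have h1 := congrArg (· ⬝ᵥ (p : ι → ℝ)) h0
    have hpp : (p : ι → ℝ) ⬝ᵥ p ≠ 0 := fun h => p.2 (dotProduct_self_eq_zero.1 h)
    have hcos : Real.cos t = 0 := by
      simpa [add_dotProduct, smul_dotProduct, hep, hpp] using h1
    have hsin : Real.sin t = 0 := by simpa [hcos, he] using h0
    simpa [hcos, hsin] using Real.sin_sq_add_cos_sq t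
  let γ : Unit × ℝ → {v : ι → ℝ // v ≠ 0} := fun t =>
    ⟨Real.cos (Real.pi * t.2) • (p : ι → ℝ) + Real.sin (Real.pi * t.2) • e, hγne _⟩
  have hγ : Continuous γ := Continuous.subtype_mk (by fun_prop) _
  obtain ⟨N, hN, hstep⟩ := exists_nat_steps_mem γ hγ {q | 0 < (T q).det}
    (isOpen_Ioi.preimage (f := fun q => (T q).det) (by fun_prop)) (fun v => by simp [hTd])
  have main : ∀ k : ℕ, k ≤ N → ∃ M : Matrix ι ι ℝ, 0 < M.det ∧
      M *ᵥ p = γ ((), (k : ℝ) / N) ∧ M * I p = I (γ ((), (k : ℝ) / N)) * M := by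
    intro k
    induction k with
    | zero =>
      intro _
      have : γ ((), ((0 : ℕ) : ℝ) / N) = p := Subtype.ext (by simp [γ])
      exact ⟨1, by simp, by rw [this, one_mulVec], by rw [this, one_mul, mul_one]⟩
    | succ k ih =>
      intro hk
      obtain ⟨M, hM, hMp, hMI⟩ := ih (by omega)
      refine ⟨T (γ ((), ((k + 1 : ℕ) : ℝ) / N), γ ((), (k : ℝ) / N)) * M, ?_, ?_, ?_⟩
      · rw [det_mul]
        exact mul_pos (hstep () k hk) hM
      · rw [← mulVec_mulVec, hMp, hTv]
      · rw [mul_assoc, hMI, ← mul_assoc, hTI, mul_assoc]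
  obtain ⟨M, hM, hMp, hMI⟩ := main N le_rfl
  have hend : γ ((), (N : ℝ) / N) = p' := by
    have : (N : ℝ) / N = 1 := div_self (by positivity)
    exact Subtype.ext (by simp [γ, this, hneg])
  rw [hend, hneg] at hMp
  rw [hend, hI'] at hMI
  let R := vecMulVec (p : ι → ℝ) (l p)
  have hR : R = 1 + I p * I p := by rw [hII]; abel
  have hRR : R * R = R := by
    simp only [R, vecMulVec_mul_vecMulVec, hlv, one_smul]
  have hMR : M * R = -R := by
    simp only [R, mul_vecMulVec, hMp, neg_vecMulVec]
  have hdet : (1 - (2 : ℝ) • R).det = -1 := by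
    have h1 := det_one_add_replicateCol_mul_replicateRow (ι := Unit) (-(2 : ℝ) • (p : ι → ℝ)) (l p)
    rw [← vecMulVec_eq, smul_vecMulVec, dotProduct_smul, hlv, neg_smul, ← sub_eq_add_neg] at h1
    rw [h1]
    norm_num
  have hnonneg := det_nonneg_of_commute (M * (1 - (2 : ℝ) • R)) (I p)
    (by rw [hIIQ, neg_mul, hQI])
    (by
      rw [← hR, mul_assoc, sub_mul, one_mul, smul_mul_assoc, hRR, mul_sub, mul_smul_comm, hMR]
      rw [two_smul]; abel)
    (by
      have h1 : (1 - (2 : ℝ) • R) * I p = I p := by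
        simp [R, sub_mul, vecMulVec_mul, hlI]
      have h2 : I p * (1 - (2 : ℝ) • R) = I p := by
        simp [R, mul_sub, mul_vecMulVec, hIv]
      rw [mul_assoc, h1, ← mul_assoc, ← hMI, mul_assoc, h2])
  rw [det_mul, hdet] at hnonneg
  linarith

lemma aeval_mulVec_of_mulVec_eq_smul {ι K : Type*} [Fintype ι] [DecidableEq ι] [Field K]
    {N : Matrix ι ι K} {v : ι → K} {c : K} (h : N *ᵥ v = c • v) (q : K[X]) :
    aeval N q *ᵥ v = q.eval c • v := by
  obtain ⟨k, hk⟩ := X_sub_C_dvd_sub_C_eval (a := c) (p := q)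
  have h1 := congrArg (aeval N · *ᵥ v) hk
  simp only [map_sub, aeval_C, mul_comm (X - C c), map_mul, aeval_X, ← mulVec_mulVec, sub_mulVec, h,
    Algebra.algebraMap_eq_smul_one, smul_mulVec, one_mulVec, sub_self, mulVec_zero] at h1
  exact sub_eq_zero.1 h1

lemma aeval_charpoly_eq_zero_iff {ι : Type*} [Fintype ι] [DecidableEq ι]
    {M : Matrix ι ι ℝ} {z : ℂ} : aeval z M.charpoly = 0 ↔
      ∃ w : ι → ℂ, w ≠ 0 ∧ Complex.ofRealAm.mapMatrix M *ᵥ w = z • w := by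
  have h1 : aeval z M.charpoly =
      (Matrix.scalar ι z - Complex.ofRealAm.mapMatrix M).det := by
    rw [← eval_charpoly, aeval_def, ← eval_map, ← charpoly_map]
    rfl
  have h2 : ∀ w : ι → ℂ, Matrix.scalar ι z *ᵥ w = z • w := fun w => by
    ext i; simp [mulVec_diagonal]
  simp only [h1, ← exists_mulVec_eq_zero_iff, sub_mulVec, h2, sub_eq_zero, eq_comm (a := z • _)]

lemma aeval_charpoly_smul_eq_zero_iff {ι : Type*} [Fintype ι] [DecidableEq ι]
    {M : Matrix ι ι ℝ} {z : ℂ} {k : ℝ} (hk : k ≠ 0) :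
    aeval z (k⁻¹ • M).charpoly = 0 ↔ aeval ((k : ℂ) * z) M.charpoly = 0 := by
  have hk' : (k : ℂ) ≠ 0 := Complex.ofReal_ne_zero.2 hk
  have h : Complex.ofRealAm.mapMatrix (k⁻¹ • M) =
      (k : ℂ)⁻¹ • (Complex.ofRealAm.mapMatrix M : Matrix ι ι ℂ) := by
    ext i j; simp
  simp only [aeval_charpoly_eq_zero_iff, h, smul_mulVec, inv_smul_eq_iff₀ hk', smul_smul]

lemma norm_le_of_aeval_charpoly_eq_zero {ι : Type*} [Fintype ι] [DecidableEq ι]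
    {M : Matrix ι ι ℝ} {z : ℂ} (hz : aeval z M.charpoly = 0) : ‖z‖ ≤ ∑ i, ∑ j, |M i j| := by
  obtain ⟨w, hw0, hw⟩ := aeval_charpoly_eq_zero_iff.1 hz
  refine le_of_mul_le_mul_right ?_ (norm_pos_iff.2 hw0)
  rw [← norm_smul, ← hw]
  refine (pi_norm_le_iff_of_nonneg (by positivity)).2 fun i => ?_
  calc ‖∑ j, (M i j : ℂ) * w j‖ ≤ ∑ j, |M i j| * ‖w‖ := norm_sum_le_of_le _ fun j _ => by
        rw [norm_mul, Complex.norm_real, Real.norm_eq_abs]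
        exact mul_le_mul_of_nonneg_left (norm_le_pi_norm w j) (abs_nonneg _)
    _ = (∑ j, |M i j|) * ‖w‖ := (Finset.sum_mul ..).symm
    _ ≤ _ := mul_le_mul_of_nonneg_right (Finset.single_le_sum (f := fun i => ∑ j, |M i j|)
        (fun i _ => by positivity) (Finset.mem_univ i)) (norm_nonneg _)

lemma aeval_eq_zero_of_aeval_matrix_eq_zero {ι : Type*} [Fintype ι] [DecidableEq ι]
    {M : Matrix ι ι ℝ} {q : ℝ[X]} {z : ℂ} (hz : aeval z M.charpoly = 0) (hq : aeval M q = 0) :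
    aeval z q = 0 := by
  obtain ⟨w, hw, hw0⟩ := aeval_charpoly_eq_zero_iff.1 hz
  have h := aeval_mulVec_of_mulVec_eq_smul hw0 (q.map (algebraMap ℝ ℂ))
  rw [aeval_map_algebraMap, aeval_algHom_apply, hq, map_zero, zero_mulVec, eval_map_algebraMap] at h
  exact (smul_eq_zero.1 h.symm).resolve_right hw

lemma dvd_pow_of_aeval_eq_zero {f q : ℝ[X]} {m : ℕ} (hf : f ≠ 0) (hm : f.natDegree ≤ m)
    (h : ∀ z : ℂ, aeval z f = 0 → aeval z q = 0) : f ∣ q ^ m := by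
  classical
  rcases eq_or_ne q 0 with rfl | hq
  · rcases Nat.eq_zero_or_pos m with rfl | hm0
    · exact (isUnit_iff_degree_eq_zero.2 (by
        rw [degree_eq_natDegree hf, Nat.le_zero.1 hm]; rfl)).dvd
    · simp [hm0.ne']
  rw [← map_dvd_map' (algebraMap ℝ ℂ)]
  have hf' : f.map (algebraMap ℝ ℂ) ≠ 0 := map_ne_zero hf
  refine (IsAlgClosed.splits _).dvd_of_roots_le_roots hf' ?_
  rw [Polynomial.map_pow, roots_pow, Multiset.le_iff_count]
  intro z
  rw [Multiset.count_nsmul]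
  by_cases hz : z ∈ (f.map (algebraMap ℝ ℂ)).roots
  · have hz' : z ∈ (q.map (algebraMap ℝ ℂ)).roots := by
      rw [mem_roots hf', IsRoot, eval_map_algebraMap] at hz
      rw [mem_roots (map_ne_zero hq), IsRoot, eval_map_algebraMap]
      exact h z hz
    calc _ ≤ m := (Multiset.count_le_card _ _).trans
          ((card_roots' _).trans (natDegree_map_le.trans hm))
      _ ≤ _ := Nat.le_mul_of_pos_right _ (Multiset.count_pos.2 hz')
  · simp [Multiset.count_eq_zero_of_notMem hz]

/-- Adding a multiple `c` of the projection onto a kernel vector moves one root `0` of the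
characteristic polynomial to `c`. -/
lemma exists_charpoly_add_smul_vecMulVec {ι : Type*} [Fintype ι] [DecidableEq ι]
    {M : Matrix ι ι ℝ} {v : ι → ℝ} (hv : v ≠ 0) (hM : M *ᵥ v = 0) :
    ∃ g : ℝ[X], g.Monic ∧ g.natDegree + 1 = Fintype.card ι ∧ M.charpoly = X * g ∧
      ∀ c : ℝ, (M + (c / (v ⬝ᵥ v)) • vecMulVec v v).charpoly = (X - C c) * g := by
  have hvv : v ⬝ᵥ v ≠ 0 := fun h => hv (dotProduct_self_eq_zero.1 h)
  have hne : Nonempty ι := (Function.ne_iff.1 hv).nonempty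
  obtain ⟨n, hn⟩ := Nat.exists_eq_succ_of_ne_zero (Fintype.card_ne_zero (α := ι))
  have key : ∀ c : ℝ, X * (M + (c / (v ⬝ᵥ v)) • vecMulVec v v).charpoly =
      (X - C c) * M.charpoly := by
    intro c
    have h1 : charmatrix M * charmatrix ((c / (v ⬝ᵥ v)) • vecMulVec v v) =
        (X : ℝ[X]) • charmatrix (M + (c / (v ⬝ᵥ v)) • vecMulVec v v) := by
      have h2 : (C : ℝ →+* ℝ[X]).mapMatrix M * (C : ℝ →+* ℝ[X]).mapMatrix
          ((c / (v ⬝ᵥ v)) • vecMulVec v v) = 0 := by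
        rw [← map_mul, mul_smul_comm, mul_vecMulVec, hM, zero_vecMulVec, smul_zero, map_zero]
      simp only [charmatrix, map_add, sub_mul, mul_sub, h2, scalar_apply, ← smul_one_eq_diagonal,
        smul_mul_assoc, mul_smul_comm, one_mul, mul_one, smul_sub, smul_add]
      abel
    have h3 : ((c / (v ⬝ᵥ v)) • vecMulVec v v).charpoly = (X - C c) * X ^ n := by
      rw [← smul_vecMulVec, charpoly_vecMulVec, smul_dotProduct, smul_eq_mul, div_mul_cancel₀ _ hvv,
        hn, Nat.succ_sub_one, smul_eq_C_mul, Nat.succ_eq_add_one, pow_succ']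
      ring
    have h4 := congrArg Matrix.det h1
    rw [det_mul, det_smul, hn] at h4
    change M.charpoly * Matrix.charpoly _ = _ * Matrix.charpoly _ at h4
    rw [h3] at h4
    refine mul_left_cancel₀ (pow_ne_zero n (X_ne_zero (R := ℝ))) ?_
    rw [← mul_assoc, ← pow_succ, ← Nat.succ_eq_add_one, ← h4]
    ring
  have h0 : X ∣ M.charpoly := by
    have h1 := congrArg (eval 0) (key 1)
    rw [X_dvd_iff, coeff_zero_eq_eval_zero]
    simpa using h1.symm
  obtain ⟨g, hg⟩ := h0
  have hmon : g.Monic := monic_X.of_mul_monic_left (hg ▸ charpoly_monic M)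
  refine ⟨g, hmon, ?_, hg, fun c => ?_⟩
  · have := charpoly_natDegree_eq_dim M
    rw [hg, natDegree_X_mul hmon.ne_zero] at this
    exact this
  · refine mul_left_cancel₀ (X_ne_zero (R := ℝ)) ?_
    rw [key, hg]
    ring

/-- The spectrum of a continuous family `N` of matrices with `N v *ᵥ v = c • v` on an
odd-dimensional space cannot be split by a fixed coprime factorization. -/
theorem no_coprime_splitting {ι : Type*} [Fintype ι] [DecidableEq ι]
    (hodd : Odd (Fintype.card ι)) (N : {v : ι → ℝ // v ≠ 0} → Matrix ι ι ℝ) (hN : Continuous N)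
    (c : ℝ) (hNv : ∀ v, N v *ᵥ (v : ι → ℝ) = c • (v : ι → ℝ)) (a b : ℝ[X]) (hab : IsCoprime a b)
    (hc : (a * b).eval c ≠ 0) (hNab : ∀ v, aeval (N v) ((X - C c) * (a * b)) = 0)
    (p p' : {v : ι → ℝ // v ≠ 0}) (hneg : (p' : ι → ℝ) = -p)
    (z z' : ℂ) (hz : aeval z (N p).charpoly = 0) (hz' : aeval z' (N p').charpoly = 0)
    (haz : aeval z a = 0) (hbz : aeval z' b = 0) : False := by
  obtain ⟨u, w, huw⟩ := hab
  let h : ℝ[X] := 1 - C ((a * b).eval c)⁻¹ * (a * b)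
  have hhc : h.eval c = 0 := by
    rw [eval_sub, eval_mul, eval_C, eval_one, inv_mul_cancel₀ hc, sub_self]
  obtain ⟨k, hk⟩ := dvd_iff_isRoot.2 hhc
  have hdvd : ∀ v q, aeval (N v) ((X - C c) * (a * b) * q) = 0 := fun v q => by
    rw [map_mul, hNab, zero_mul]
  have hcont : ∀ q : ℝ[X], Continuous fun v => aeval (N v) q := fun q => by
    simp only [aeval_eq_sum_range]
    fun_prop
  let e := w * b * h
  let f := u * a * h
  have hee : e * e = e + (X - C c) * (a * b) *
      (w * k * (-u - w * b * C ((a * b).eval c)⁻¹ * b)) := by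
    have h1 : w * b * h - 1 = a * (-u - w * b * C ((a * b).eval c)⁻¹ * b) := by
      simp only [h]
      linear_combination huw
    have h2 : e * e = e + w * b * h * (w * b * h - 1) := by simp only [e]; ring
    rw [h2, h1]
    nth_rewrite 1 [hk]
    ring
  have hff : f * f = f + (X - C c) * (a * b) *
      (u * k * (-w - u * a * C ((a * b).eval c)⁻¹ * a)) := by
    have h1 : u * a * h - 1 = b * (-w - u * a * C ((a * b).eval c)⁻¹ * a) := by
      simp only [h]
      linear_combination huw
    have h2 : f * f = f + u * a * h * (u * a * h - 1) := by simp only [f]; ring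
    rw [h2, h1]
    nth_rewrite 1 [hk]
    ring
  have hef : e * f = (X - C c) * (a * b) * (w * u * k * h) := by
    have h2 : e * f = w * u * a * b * h * h := by simp only [e, f]; ring
    rw [h2]
    nth_rewrite 1 [hk]
    ring
  have hzero : ∀ q : ℝ[X], q.eval c = 0 → ∀ v : {v : ι → ℝ // v ≠ 0},
      aeval (N v) q *ᵥ (v : ι → ℝ) = 0 := fun q hq v => by
    rw [aeval_mulVec_of_mulVec_eq_smul (hNv v), hq, zero_smul]
  refine no_complementary_projections hodd (fun v => aeval (N v) e) (fun v => aeval (N v) f)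
    (hcont e) (hcont f) (fun v => ?_) (fun v => ?_) (fun v => ?_)
    (hzero e (by simp [e, hhc])) (hzero f (by simp [f, hhc])) p p' hneg
    (fun h0 => ?_) (fun h0 => ?_)
  · rw [← map_mul, hee, map_add, hdvd, add_zero]
  · rw [← map_mul, hff, map_add, hdvd, add_zero]
  · rw [← map_mul, hef, hdvd]
  · have h1 := aeval_eq_zero_of_aeval_matrix_eq_zero hz h0
    have h2 := congrArg (aeval z) huw
    simp only [map_add, map_mul, haz, mul_zero, zero_add, map_one] at h2
    simp [e, h, haz, h2] at h1
  · have h1 := aeval_eq_zero_of_aeval_matrix_eq_zero hz' h0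
    have h2 := congrArg (aeval z') huw
    simp only [map_add, map_mul, hbz, mul_zero, add_zero, map_one] at h2
    simp [f, h, hbz, h2] at h1

/-- A continuous even family `N` with simple eigenvector `N v *ᵥ v = c • v` cannot have a fixed
polynomial `q` in `N` inducing a complex structure on the remaining part of the space. -/
theorem no_polynomial_complex_structure {ι : Type*} [Fintype ι] [DecidableEq ι] [Nontrivial ι]
    (N : {v : ι → ℝ // v ≠ 0} → Matrix ι ι ℝ) (hN : Continuous N)
    (c : ℝ) (hNv : ∀ v, N v *ᵥ (v : ι → ℝ) = c • (v : ι → ℝ))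
    (hsimple : ∀ (v : {v : ι → ℝ // v ≠ 0}) x, N v *ᵥ x = c • x → ∃ a : ℝ, x = a • (v : ι → ℝ))
    (q : ℝ[X]) (hq : ∀ v, aeval (N v) ((X - C c) * (q ^ 2 + 1)) = 0)
    (p p' : {v : ι → ℝ // v ≠ 0}) (hneg : (p' : ι → ℝ) = -p) (hN' : N p' = N p) : False := by
  let d : ℝ := q.eval c ^ 2 + 1
  have hd : d ≠ 0 := by positivity
  let r : ℝ[X] := C d⁻¹ * (q ^ 2 + 1)
  have hcont : ∀ q : ℝ[X], Continuous fun v => aeval (N v) q := fun q => by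
    simp only [aeval_eq_sum_range]
    fun_prop
  have hvv : ∀ v : {v : ι → ℝ // v ≠ 0}, (v : ι → ℝ) ⬝ᵥ v ≠ 0 :=
    fun v h => v.2 (dotProduct_self_eq_zero.1 h)
  have hdvd : ∀ v k, aeval (N v) ((X - C c) * (q ^ 2 + 1) * k) = 0 := fun v k => by
    rw [map_mul, hq, zero_mul]
  have hrv : ∀ v : {v : ι → ℝ // v ≠ 0}, aeval (N v) r *ᵥ (v : ι → ℝ) = v := by
    intro v
    rw [aeval_mulVec_of_mulVec_eq_smul (hNv v)]
    simp only [r, eval_mul, eval_C, eval_add, eval_pow, eval_one]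
    rw [inv_mul_cancel₀ hd, one_smul]
  let l : {v : ι → ℝ // v ≠ 0} → ι → ℝ := fun v =>
    ((v : ι → ℝ) ⬝ᵥ v)⁻¹ • ((v : ι → ℝ) ᵥ* aeval (N v) r)
  have hrl : ∀ v, aeval (N v) r = vecMulVec v (l v) := by
    intro v
    refine Matrix.ext_iff_mulVec.2 fun x => ?_
    obtain ⟨a, ha⟩ := hsimple v (aeval (N v) r *ᵥ x) (by
      have h1 : aeval (N v) ((X - C c) * r) = 0 := by
        rw [show (X - C c) * r = (X - C c) * (q ^ 2 + 1) * C d⁻¹ by simp only [r]; ring, hdvd]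
      rw [map_mul, map_sub, aeval_X, aeval_C, sub_mul, sub_eq_zero] at h1
      rw [mulVec_mulVec, h1, ← mulVec_mulVec, Algebra.algebraMap_eq_smul_one, smul_mulVec,
        one_mulVec])
    rw [vecMulVec_mulVec, ha]
    simp only [l, smul_dotProduct, ← dotProduct_mulVec, ha, dotProduct_smul, smul_eq_mul]
    rw [mul_comm a, inv_mul_cancel_left₀ (hvv v)]
    simp
  obtain ⟨k, hk⟩ : X - C c ∣ 1 - r := by
    refine dvd_iff_isRoot.2 ?_
    simp only [r, IsRoot, eval_sub, eval_mul, eval_C, eval_add, eval_pow, eval_one]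
    rw [inv_mul_cancel₀ hd, sub_self]
  have hr0 : ∀ v, aeval (N v) (r * (1 - r)) = 0 := fun v => by
    rw [hk, show r * ((X - C c) * k) = (X - C c) * (q ^ 2 + 1) * (C d⁻¹ * k) by
      simp only [r]; ring, hdvd]
  refine no_even_complex_structure (fun v => aeval (N v) (q * (1 - r))) l (hcont _) ?_
    (fun v => ?_) (fun v => ?_) (fun v => ?_) (fun v => ?_) p p' hneg (by rw [hN'])
  · have := hcont r
    have h2 : Continuous fun v : {v : ι → ℝ // v ≠ 0} => ((v : ι → ℝ) ⬝ᵥ v)⁻¹ :=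
      (continuous_subtype_val.dotProduct continuous_subtype_val).inv₀ hvv
    fun_prop
  · simp only [l, smul_dotProduct, ← dotProduct_mulVec, hrv, smul_eq_mul, inv_mul_cancel₀ (hvv v)]
  · have h1 : q * (1 - r) * (q * (1 - r)) =
        r - 1 + r * (1 - r) * (1 + C d * (1 - r)) + (1 - r) ^ 2 * (q ^ 2 + 1 - C d * r) := by
      ring
    have h2 : q ^ 2 + 1 - C d * r = 0 := by
      simp only [r]
      rw [← mul_assoc, ← C_mul, mul_inv_cancel₀ hd, C_1, one_mul, sub_self]
    rw [← hrl, ← map_mul, h1, h2, mul_zero, add_zero, map_add, map_mul, hr0, zero_mul, add_zero,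
      map_sub, map_one]
  · rw [map_mul, ← mulVec_mulVec, map_sub, map_one, sub_mulVec, one_mulVec, hrv, sub_self,
      mulVec_zero]
  · simp only [l, smul_vecMul, vecMul_vecMul]
    rw [← map_mul, show r * (q * (1 - r)) = r * (1 - r) * q by ring, map_mul, hr0, zero_mul,
      vecMul_zero, smul_zero]

lemma exists_pow_dvd_sq_add_one (q : ℝ[X]) (m : ℕ) : ∃ r : ℝ[X], (q ^ 2 + 1) ^ m ∣ r ^ 2 + 1 := by
  rcases Nat.eq_zero_or_pos m with rfl | hm
  · exact ⟨q, by simp⟩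
  induction m, hm using Nat.le_induction with
  | base => exact ⟨q, by simp⟩
  | succ m hm ih =>
    obtain ⟨r, hr⟩ := ih
    refine ⟨r + C (1 / 2) * (r ^ 2 + 1) * r, ?_⟩
    have h1 : (r + C (1 / 2) * (r ^ 2 + 1) * r) ^ 2 + 1 =
        (r ^ 2 + 1) ^ 2 * (1 + C (1 / 4) * r ^ 2) := by
      have h2 : (C (1 / 2) : ℝ[X]) * 2 = 1 := by
        rw [← C_ofNat, ← C_mul]; norm_num
      have h4 : (C (1 / 4) : ℝ[X]) = C (1 / 2) ^ 2 := by
        rw [← C_pow]; norm_num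
      rw [h4]
      linear_combination r ^ 2 * (r ^ 2 + 1) * h2
    rw [h1]
    calc (q ^ 2 + 1) ^ (m + 1) ∣ (q ^ 2 + 1) ^ (m * 2) := pow_dvd_pow _ (by omega)
      _ ∣ (r ^ 2 + 1) ^ 2 := by rw [pow_mul]; exact pow_dvd_pow_of_dvd hr 2
      _ ∣ _ := Dvd.intro _ rfl

/-- A non-real complex number is mapped to a square root of `-1` by a real polynomial `q` such that
`q ^ 2` is even. -/
lemma exists_aeval_sq_add_one_eq_zero {z : ℂ} (hz : z.im ≠ 0) :
    ∃ q : ℝ[X], aeval z (q ^ 2 + 1) = 0 ∧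
      ∀ w : ℂ, aeval (-w) (q ^ 2 + 1) = aeval w (q ^ 2 + 1) := by
  rcases eq_or_ne z.re 0 with h | h
  · refine ⟨C z.im⁻¹ * X, ?_, fun w => ?_⟩
    · have h1 : z = z.im * Complex.I := by
        apply Complex.ext <;> simp [h]
      have h2 : (z.im : ℂ) ≠ 0 := by exact_mod_cast hz
      have h3 : aeval z (C z.im⁻¹ * X : ℝ[X]) = Complex.I := by
        simp only [map_mul, aeval_C, aeval_X, Complex.coe_algebraMap, Complex.ofReal_inv]
        nth_rewrite 2 [h1]
        rw [inv_mul_cancel_left₀ h2]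
      simp [-map_mul, h3]
    · simp
  · refine ⟨C (2 * z.re * z.im)⁻¹ * (X ^ 2 - C (z.re ^ 2 - z.im ^ 2)), ?_, fun w => by simp⟩
    have h2 : ((2 * z.re * z.im : ℝ) : ℂ) ≠ 0 := by
      exact_mod_cast mul_ne_zero (mul_ne_zero two_ne_zero h) hz
    have h1 : z ^ 2 - ((z.re ^ 2 - z.im ^ 2 : ℝ) : ℂ) =
        ((2 * z.re * z.im : ℝ) : ℂ) * Complex.I := by
      apply Complex.ext <;> simp [pow_two]
      ring
    have h3 : aeval z (C (2 * z.re * z.im)⁻¹ * (X ^ 2 - C (z.re ^ 2 - z.im ^ 2)) : ℝ[X]) =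
        Complex.I := by
      rw [map_mul, aeval_C, map_sub, map_pow, aeval_X, aeval_C, Complex.coe_algebraMap, h1,
        Complex.ofReal_inv, inv_mul_cancel_left₀ h2]
    rw [map_add, map_pow, h3, map_one, Complex.I_sq, neg_add_cancel]

lemma aeval_mul_comp_neg_X_eq_zero {f : ℝ[X]} {z : ℂ} (h : aeval z f = 0 ∨ aeval (-z) f = 0) :
    aeval z (f * f.comp (-X)) = 0 := by
  rw [map_mul, aeval_comp, map_neg, aeval_X, mul_eq_zero]
  exact h

/-- If a continuous even family of matrices `M v` with `M v *ᵥ v = 0` on an odd-dimensional space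
has constant nontrivial spectrum up to sign, then `M v` has a single nonzero eigenvalue, which is
real and has multiplicity one less than the dimension. -/
theorem charpoly_eq_of_spectrum_constant_up_to_sign {ι : Type*} [Fintype ι] [DecidableEq ι]
    [Nontrivial ι] (hodd : Odd (Fintype.card ι)) (M : {v : ι → ℝ // v ≠ 0} → Matrix ι ι ℝ)
    (hM : Continuous M) (hMv : ∀ v, M v *ᵥ (v : ι → ℝ) = 0)
    (heven : ∀ v v' : {v : ι → ℝ // v ≠ 0}, (v' : ι → ℝ) = -v → M v' = M v)
    (hspec : ∀ v w, ∀ z : ℂ, aeval z (M v).charpoly = 0 →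
      aeval z (M w).charpoly = 0 ∨ aeval (-z) (M w).charpoly = 0)
    (hne : ∀ v, ∃ z : ℂ, z ≠ 0 ∧ aeval z (M v).charpoly = 0) (p : {v : ι → ℝ // v ≠ 0}) :
    ∃ r : ℝ, r ≠ 0 ∧ (M p).charpoly = X * (X - C r) ^ (Fintype.card ι - 1) := by
  have hcard : 1 < Fintype.card ι := Fintype.one_lt_card
  have hvv : ∀ v : {v : ι → ℝ // v ≠ 0}, (v : ι → ℝ) ⬝ᵥ v ≠ 0 :=
    fun v h => v.2 (dotProduct_self_eq_zero.1 h)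
  choose g hgmon hgdeg hgM hgN using fun v : {v : ι → ℝ // v ≠ 0} =>
    exists_charpoly_add_smul_vecMulVec v.2 (hMv v)
  have hroot : ∀ v, ∀ z : ℂ, aeval z (g v) = 0 → aeval z (M v).charpoly = 0 := fun v z hz => by
    rw [hgM, map_mul, hz, mul_zero]
  obtain ⟨c, hc⟩ : ∃ c : ℝ, eval c ((M p).charpoly * (M p).charpoly.comp (-X)) ≠ 0 := by
    by_contra! h
    have h0 := Polynomial.funext (q := 0) (fun x => by rw [h x, eval_zero])
    rw [mul_eq_zero, comp_neg_X_eq_zero_iff, or_self] at h0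
    exact (charpoly_monic (M p)).ne_zero h0
  have hcv : ∀ v, (M v).charpoly.eval c ≠ 0 ∧ (M v).charpoly.eval (-c) ≠ 0 := by
    have h1 : (M p).charpoly.eval c ≠ 0 ∧ (M p).charpoly.eval (-c) ≠ 0 := by
      simpa [eval_comp] using hc
    have h2 : ∀ (f : ℝ[X]) (x : ℝ), aeval (x : ℂ) f = 0 ↔ f.eval x = 0 := fun f x => by
      rw [← Complex.coe_algebraMap, aeval_algebraMap_apply_eq_algebraMap_eval]
      simp
    have h3 : ∀ v, ∀ x : ℝ, (M v).charpoly.eval x = 0 →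
        (M p).charpoly.eval x = 0 ∨ (M p).charpoly.eval (-x) = 0 := fun v x hx => by
      simpa only [← Complex.ofReal_neg, h2] using hspec v p x ((h2 _ x).2 hx)
    refine fun v => ⟨fun h => (h3 v c h).elim h1.1 h1.2, fun h => (h3 v (-c) h).elim h1.2 ?_⟩
    rw [neg_neg]
    exact h1.1
  let N : {v : ι → ℝ // v ≠ 0} → Matrix ι ι ℝ := fun v =>
    M v + (c / ((v : ι → ℝ) ⬝ᵥ v)) • vecMulVec (v : ι → ℝ) v
  have hN : Continuous N := by
    have h2 : Continuous fun v : {v : ι → ℝ // v ≠ 0} => c / ((v : ι → ℝ) ⬝ᵥ v) :=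
      continuous_const.div (continuous_subtype_val.dotProduct continuous_subtype_val) hvv
    fun_prop
  have hNv : ∀ v, N v *ᵥ (v : ι → ℝ) = c • (v : ι → ℝ) := fun v => by
    simp only [N, add_mulVec, hMv, zero_add, smul_mulVec, vecMulVec_mulVec]
    rw [op_smul_eq_smul, smul_smul, div_mul_cancel₀ _ (hvv v)]
  have hNeven : ∀ v v' : {v : ι → ℝ // v ≠ 0}, (v' : ι → ℝ) = -v → N v' = N v := by
    intro v v' h
    simp only [N, heven v v' h, h, neg_vecMulVec, vecMulVec_neg, neg_neg, neg_dotProduct,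
      dotProduct_neg]
  have hNdvd : ∀ f : ℝ[X], (∀ v, g v ∣ f) → ∀ v, aeval (N v) ((X - C c) * f) = 0 := by
    intro f hf v
    obtain ⟨k, hk⟩ := hf v
    rw [hk, ← mul_assoc, ← hgN, map_mul, aeval_self_charpoly, zero_mul]
  have hgpow : ∀ f : ℝ[X], (∀ v, ∀ z : ℂ, aeval z (g v) = 0 → aeval z f = 0) →
      ∀ v, g v ∣ f ^ Fintype.card ι := fun f hf v =>
    dvd_pow_of_aeval_eq_zero (hgmon v).ne_zero (by have := hgdeg v; omega) (hf v)
  have hNroot : ∀ v, ∀ z : ℂ, aeval z (g v) = 0 → aeval z (N v).charpoly = 0 := fun v z hz => by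
    rw [hgN, map_mul, hz, mul_zero]
  -- All nonzero eigenvalues are conjugate to each other.
  have hconj : ∀ v, ∀ z z' : ℂ, aeval z (g v) = 0 → aeval z' (g v) = 0 →
      aeval z' (minpoly ℝ z) = 0 := by
    intro v z z' hz hz'
    by_contra hzz
    let f := (M v).charpoly * (M v).charpoly.comp (-X)
    have hf0 : f ≠ 0 := by
      refine mul_ne_zero (charpoly_monic _).ne_zero ?_
      rw [Ne, comp_neg_X_eq_zero_iff]
      exact (charpoly_monic _).ne_zero
    have hfv : ∀ w, ∀ z : ℂ, aeval z (g w) = 0 → aeval z f = 0 := fun w z hz =>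
      aeval_mul_comp_neg_X_eq_zero (hspec w v z (hroot w z hz))
    have hirr : Irreducible (minpoly ℝ z) := minpoly.irreducible (Algebra.IsIntegral.isIntegral z)
    obtain ⟨b, hb, hbdvd⟩ := (FiniteMultiplicity.of_not_isUnit hirr.not_isUnit
      (pow_ne_zero (Fintype.card ι) hf0)).exists_eq_pow_mul_and_not_dvd
    set k := multiplicity (minpoly ℝ z) (f ^ Fintype.card ι)
    have hzf : aeval z (f ^ Fintype.card ι) = 0 := by
      rw [map_pow, hfv v z hz, zero_pow (by omega)]
    have hzf' : aeval z' (f ^ Fintype.card ι) = 0 := by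
      rw [map_pow, hfv v z' hz', zero_pow (by omega)]
    refine no_coprime_splitting hodd N hN c hNv (minpoly ℝ z ^ k) b
      ((hirr.coprime_iff_not_dvd.2 hbdvd).pow_left) ?_ (fun w => ?_) v ⟨-v, neg_ne_zero.2 v.2⟩ rfl
      z z' (hNroot v z hz) (by rw [hNeven v _ rfl]; exact hNroot v z' hz') ?_ ?_
    · rw [← hb, eval_pow, eval_mul, eval_comp, eval_neg, eval_X]
      exact pow_ne_zero _ (mul_ne_zero (hcv v).1 (hcv v).2)
    · rw [← hb]
      exact hNdvd _ (hgpow f hfv) w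
    · by_contra h0
      rw [hb, map_mul, mul_eq_zero, or_iff_right h0] at hzf
      exact hbdvd (minpoly.dvd ℝ z hzf)
    · rw [hb, map_mul, mul_eq_zero, map_pow, or_iff_right (pow_ne_zero _ hzz)] at hzf'
      exact hzf'
  have hg0 : ∀ v, ∀ z : ℂ, aeval z (g v) = 0 → z ≠ 0 := by
    rintro v z hz rfl
    obtain ⟨w, hw0, hw⟩ := hne v
    rw [hgM, map_mul, aeval_X, mul_eq_zero, or_iff_right hw0] at hw
    have := hconj v 0 w hz hw
    rw [minpoly.zero, aeval_X] at this
    exact hw0 this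
  obtain ⟨z, hz⟩ : ∃ z : ℂ, aeval z (g p) = 0 := by
    refine IsAlgClosed.exists_aeval_eq_zero ℂ (g p) fun h => ?_
    have h0 : (g p).natDegree = 0 := natDegree_eq_of_degree_eq_some h
    have := hgdeg p
    omega
  have hzim : z.im = 0 := by
    by_contra him
    obtain ⟨q, hqz, hqneg⟩ := exists_aeval_sq_add_one_eq_zero him
    have hq : ∀ v, ∀ w : ℂ, aeval w (g v) = 0 → aeval w (q ^ 2 + 1) = 0 := by
      have h1 : ∀ w : ℂ, w ≠ 0 → aeval w (M p).charpoly = 0 → aeval w (q ^ 2 + 1) = 0 := by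
        intro w hw0 hw
        rw [hgM, map_mul, aeval_X, mul_eq_zero, or_iff_right hw0] at hw
        exact aeval_eq_zero_of_dvd_aeval_eq_zero (minpoly.dvd ℝ z hqz) (hconj p z w hz hw)
      intro v w hw
      rcases hspec v p w (hroot v w hw) with h | h
      · exact h1 w (hg0 v w hw) h
      · rw [← hqneg]
        exact h1 (-w) (neg_ne_zero.2 (hg0 v w hw)) h
    obtain ⟨r, hr⟩ := exists_pow_dvd_sq_add_one q (Fintype.card ι)
    refine no_polynomial_complex_structure N hN c hNv (fun v x hx => ?_) r
      (hNdvd _ fun v => (hgpow _ hq v).trans hr) p ⟨-p, neg_ne_zero.2 p.2⟩ rfl (hNeven p _ rfl)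
    let a := ((v : ι → ℝ) ⬝ᵥ x) / ((v : ι → ℝ) ⬝ᵥ v)
    refine ⟨a, sub_eq_zero.1 ?_⟩
    by_contra hy
    have hva : (v : ι → ℝ) ⬝ᵥ (x - a • (v : ι → ℝ)) = 0 := by
      rw [dotProduct_sub, dotProduct_smul, smul_eq_mul, div_mul_cancel₀ _ (hvv v), sub_self]
    have hMy : M v *ᵥ (x - a • (v : ι → ℝ)) = c • (x - a • (v : ι → ℝ)) := by
      have h1 : N v *ᵥ (x - a • (v : ι → ℝ)) = c • (x - a • (v : ι → ℝ)) := by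
        rw [mulVec_sub, mulVec_smul, hx, hNv, smul_sub, smul_comm a c]
      simpa [N, add_mulVec, smul_mulVec, vecMulVec_mulVec, hva] using h1
    refine (hcv v).1 ?_
    rw [eval_charpoly, ← exists_mulVec_eq_zero_iff]
    refine ⟨_, hy, ?_⟩
    rw [sub_mulVec, hMy, scalar_apply, ← smul_one_eq_diagonal, smul_mulVec, one_mulVec, sub_self]
  obtain ⟨r, rfl⟩ : ∃ r : ℝ, z = r := ⟨z.re, Complex.ext rfl hzim⟩
  refine ⟨r, fun h => hg0 p _ hz (by rw [h, Complex.ofReal_zero]), ?_⟩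
  have hdvd : g p ∣ (X - C r) ^ Fintype.card ι := by
    refine dvd_pow_of_aeval_eq_zero (hgmon p).ne_zero (by have := hgdeg p; omega) fun w hw => ?_
    have h1 := hconj p r w hz hw
    rwa [← Complex.coe_algebraMap, minpoly.eq_X_sub_C] at h1
  obtain ⟨i, -, hi⟩ := (dvd_prime_pow (prime_X_sub_C r) _).1 hdvd
  have hi' : g p = (X - C r) ^ i :=
    eq_of_monic_of_associated (hgmon p) ((monic_X_sub_C r).pow i) hi
  have hideg := hgdeg p
  rw [hi', natDegree_pow, natDegree_X_sub_C, mul_one] at hideg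
  rw [hgM, hi', ← hideg, Nat.add_sub_cancel]

lemma eq_of_forall_exists_mul_eq_mul {B : Set ℝ} (hB : B.Finite) (hne : B.Nonempty)
    (hpos : ∀ x ∈ B, 0 < x) {a b : ℝ} (ha : 0 ≤ a) (h : ∀ x ∈ B, ∃ y ∈ B, b * x = a * y) :
    a = b := by
  obtain ⟨x, hx, hmax⟩ := hB.exists_maximalFor id B hne
  obtain ⟨x', hx', hmin⟩ := hB.exists_minimalFor id B hne
  obtain ⟨y, hy, hxy⟩ := h x hx
  obtain ⟨y', hy', hxy'⟩ := h x' hx'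
  have h1 : y ≤ x := (le_total y x).elim id fun h => hmax hy h
  have h2 : x' ≤ y' := (le_total x' y').elim id fun h => hmin hy' h
  refine le_antisymm ?_ ?_
  · refine le_of_mul_le_mul_right ?_ (hpos x' hx')
    rw [hxy']
    exact mul_le_mul_of_nonneg_left h2 ha
  · refine le_of_mul_le_mul_right ?_ (hpos x hx)
    rw [hxy]
    exact mul_le_mul_of_nonneg_left h1 ha

lemma mul_comp_neg_X_ne_zero {f : ℝ[X]} (hf : f ≠ 0) : f * f.comp (-X) ≠ 0 :=
  mul_ne_zero hf (by rwa [Ne, comp_neg_X_eq_zero_iff])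

lemma aeval_scaleRoots_pow_self_eq_zero {ι : Type*} [Fintype ι] [DecidableEq ι] {f : ℝ[X]}
    {M : Matrix ι ι ℝ} {s : ℝ}
    (hM : ∀ z : ℂ, aeval z M.charpoly = 0 → ∃ w : ℂ, aeval w f = 0 ∧ z = s * w) :
    aeval M ((f * f.comp (-X)).scaleRoots |s| ^ Fintype.card ι) = 0 := by
  have hdvd : M.charpoly ∣ (f * f.comp (-X)).scaleRoots |s| ^ Fintype.card ι := by
    refine dvd_pow_of_aeval_eq_zero M.charpoly_monic.ne_zero M.charpoly_natDegree_eq_dim.le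
      fun z hz => ?_
    obtain ⟨w, hw, rfl⟩ := hM z hz
    rcases abs_choice s with h | h
    · rw [h]
      exact scaleRoots_aeval_eq_zero (aeval_mul_comp_neg_X_eq_zero (Or.inl hw))
    · have h1 : (s : ℂ) * w = algebraMap ℝ ℂ (-s) * -w := by simp
      rw [h, h1]
      exact scaleRoots_aeval_eq_zero (aeval_mul_comp_neg_X_eq_zero (Or.inr (by rwa [neg_neg])))
  obtain ⟨g, hg⟩ := hdvd
  rw [hg, map_mul, Matrix.aeval_self_charpoly, zero_mul]

lemma eq_abs_of_aeval_scaleRoots_pow_eq_zero {ι : Type*} [Fintype ι] [DecidableEq ι] {f : ℝ[X]}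
    {M : Matrix ι ι ℝ} {s y : ℝ} {m : ℕ} (hf : f ≠ 0) (hs : s ≠ 0)
    (hroot : ∃ z : ℂ, z ≠ 0 ∧ aeval z f = 0)
    (hM : ∀ z : ℂ, aeval z f = 0 → aeval (s * z) M.charpoly = 0) (hy : 0 ≤ y)
    (h : aeval M ((f * f.comp (-X)).scaleRoots y ^ m) = 0) : y = |s| := by
  have hA := mul_comp_neg_X_ne_zero hf
  have hz : ∀ z : ℂ, aeval z f = 0 → aeval (s * z) ((f * f.comp (-X)).scaleRoots y) = 0 := by
    intro z hz
    have := aeval_eq_zero_of_aeval_matrix_eq_zero (hM z hz) h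
    rw [map_pow] at this
    exact eq_zero_of_pow_eq_zero this
  obtain ⟨z₀, hz₀, hfz₀⟩ := hroot
  have hs' : (s : ℂ) ≠ 0 := by exact_mod_cast hs
  have hy' : y ≠ 0 := by
    rintro rfl
    have h0 := hz z₀ hfz₀
    rw [scaleRoots_zero, map_smul, map_pow, aeval_X, smul_eq_zero, leadingCoeff_eq_zero] at h0
    exact mul_ne_zero hs' hz₀ (eq_zero_of_pow_eq_zero (h0.resolve_left hA))
  have hyC : (y : ℂ) ≠ 0 := by exact_mod_cast hy'
  refine eq_of_forall_exists_mul_eq_mul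
    (B := (fun z : ℂ => ‖z‖) '' {z : ℂ | z ≠ 0 ∧ aeval z f = 0}) ?_
    ⟨_, z₀, ⟨hz₀, hfz₀⟩, rfl⟩ ?_ hy ?_
  · refine Set.Finite.image _ ((f.rootSet_finite ℂ).subset fun z hz => ?_)
    exact (mem_rootSet.2 ⟨hf, hz.2⟩)
  · rintro _ ⟨z, hz, rfl⟩
    exact norm_pos_iff.2 hz.1
  · rintro _ ⟨z, ⟨hz0, hfz⟩, rfl⟩
    have h1 : aeval (s * z / y) (f * f.comp (-X)) = 0 := by
      have h2 := hz z hfz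
      have h3 := scaleRoots_eval₂_mul (p := f * f.comp (-X)) (algebraMap ℝ ℂ) (s * z / y) y
      rw [Complex.coe_algebraMap, mul_div_cancel₀ _ hyC] at h3
      rw [aeval_def, h3] at h2
      exact (mul_eq_zero.1 h2).resolve_left (pow_ne_zero _ hyC)
    have h4 : |s| * ‖z‖ = y * ‖s * z / y‖ := by
      rw [norm_div, norm_mul, Complex.norm_real, Complex.norm_real, Real.norm_eq_abs,
        Real.norm_eq_abs, abs_of_nonneg hy, mul_div_cancel₀ _ hy']
    have h5 : (s * z / y : ℂ) ≠ 0 := div_ne_zero (mul_ne_zero hs' hz0) hyC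
    rw [map_mul, aeval_comp, map_neg, aeval_X, mul_eq_zero] at h1
    rcases h1 with h1 | h1
    · exact ⟨_, ⟨_, ⟨h5, h1⟩, rfl⟩, h4⟩
    · exact ⟨_, ⟨_, ⟨neg_ne_zero.2 h5, h1⟩, rfl⟩, by simpa only [norm_neg] using h4⟩

lemma continuous_aeval_scaleRoots (q : ℝ[X]) {R Y : Type*} [TopologicalSpace Y] [Ring R]
    [Algebra ℝ R] [TopologicalSpace R] [IsTopologicalRing R] [ContinuousSMul ℝ R] {M : Y → R}
    (hM : Continuous M) : Continuous fun x : ℝ × Y => aeval (M x.2) (q.scaleRoots x.1) := by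
  have h : ∀ x : ℝ × Y, aeval (M x.2) (q.scaleRoots x.1) =
      ∑ i ∈ Finset.range (q.natDegree + 1),
        (q.coeff i * x.1 ^ (q.natDegree - i)) • M x.2 ^ i := fun x => by
    rw [aeval_eq_sum_range, natDegree_scaleRoots]
    simp only [coeff_scaleRoots]
  simp only [h]
  fun_prop

/-- If the spectra of a continuous family of real matrices are pairwise proportional, then the
absolute value of the factor of proportionality is continuous. -/
lemma continuous_abs_of_spectrum_proportional {ι Y : Type*} [Fintype ι] [DecidableEq ι]
    [TopologicalSpace Y] {f : ℝ[X]} (hf : f ≠ 0) (hroot : ∃ z : ℂ, z ≠ 0 ∧ aeval z f = 0)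
    {M : Y → Matrix ι ι ℝ} (hM : Continuous M) {s : Y → ℝ} (hs : ∀ v, s v ≠ 0)
    (hMs : ∀ v, ∀ z : ℂ, aeval (s v * z) (M v).charpoly = 0 ↔ aeval z f = 0) :
    Continuous fun v => |s v| := by
  obtain ⟨z₀, hz₀, hfz₀⟩ := hroot
  have hG : Continuous fun x : ℝ × Y =>
      aeval (M x.2) ((f * f.comp (-X)).scaleRoots x.1 ^ Fintype.card ι) := by
    simp only [map_pow]
    exact (continuous_aeval_scaleRoots _ hM).pow _
  have hself : ∀ v, aeval (M v) ((f * f.comp (-X)).scaleRoots |s v| ^ Fintype.card ι) = 0 := by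
    refine fun v => aeval_scaleRoots_pow_self_eq_zero fun z hz => ?_
    have hs' : (s v : ℂ) ≠ 0 := by exact_mod_cast hs v
    refine ⟨z / s v, ?_, (mul_div_cancel₀ _ hs').symm⟩
    rw [← hMs v, mul_div_cancel₀ _ hs']
    exact hz
  have hbound : ∀ v, |s v| ≤ (∑ i, ∑ j, |M v i j|) / ‖z₀‖ := fun v => by
    have := norm_le_of_aeval_charpoly_eq_zero ((hMs v z₀).2 hfz₀)
    rw [norm_mul, Complex.norm_real, Real.norm_eq_abs] at this
    rwa [le_div_iff₀ (norm_pos_iff.2 hz₀)]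
  have hcont : Continuous fun v => (∑ i, ∑ j, |M v i j|) / ‖z₀‖ := by
    refine Continuous.div_const (continuous_finsetSum _ fun i _ => continuous_finsetSum _ fun j _ =>
      ?_) _
    exact (hM.matrix_elem i j).abs
  refine continuous_iff_continuousAt.2 fun v => ?_
  have hev := (hcont.tendsto v).eventually (eventually_le_nhds (lt_add_one _))
  refine isCompact_Icc.tendsto_nhds_of_unique_mapClusterPt
    (hev.mono fun w hw => ⟨abs_nonneg _, (hbound w).trans hw⟩) fun y hy hcl => ?_
  obtain ⟨U, hU, hlim⟩ := mapClusterPt_iff_ultrafilter.1 hcl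
  refine eq_abs_of_aeval_scaleRoots_pow_eq_zero hf (hs v) ⟨z₀, hz₀, hfz₀⟩
    (fun z hz => (hMs v z).2 hz) hy.1 (m := Fintype.card ι) ?_
  have h1 := (hG.tendsto (y, v)).comp (hlim.prodMk_nhds (Filter.tendsto_id'.2 hU))
  refine tendsto_nhds_unique h1 ?_
  refine tendsto_const_nhds.congr fun w => ?_
  exact (hself w).symm

/-- If the spectra of a continuous even family of matrices `J v` with `J v *ᵥ v = 0` on an
odd-dimensional space are nontrivial and pairwise proportional, then `J v` has a single nonzero
eigenvalue, which is real and has multiplicity one less than the dimension. -/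
theorem charpoly_eq_of_spectrum_proportional {ι : Type*} [Fintype ι] [DecidableEq ι]
    [Nontrivial ι] (hodd : Odd (Fintype.card ι)) (J : {v : ι → ℝ // v ≠ 0} → Matrix ι ι ℝ)
    (hJ : Continuous J) (hJv : ∀ v, J v *ᵥ (v : ι → ℝ) = 0)
    (heven : ∀ v v' : {v : ι → ℝ // v ≠ 0}, (v' : ι → ℝ) = -v → J v' = J v)
    (hspec : ∀ v w, ∃ s : ℝ, s ≠ 0 ∧
      ∀ z : ℂ, aeval (s * z) (J v).charpoly = 0 ↔ aeval z (J w).charpoly = 0)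
    (hne : ∀ v, ∃ z : ℂ, z ≠ 0 ∧ aeval z (J v).charpoly = 0) (p : {v : ι → ℝ // v ≠ 0}) :
    ∃ r : ℝ, r ≠ 0 ∧ (J p).charpoly = X * (X - C r) ^ (Fintype.card ι - 1) := by
  choose s hs0 hs using fun v => hspec v p
  have hf := (J p).charpoly_monic.ne_zero
  have hκ : Continuous fun v => |s v| :=
    continuous_abs_of_spectrum_proportional hf (hne p) hJ hs0 hs
  have hself : ∀ v, aeval (J v) (((J p).charpoly * (J p).charpoly.comp (-X)).scaleRoots |s v| ^
      Fintype.card ι) = 0 := by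
    refine fun v => aeval_scaleRoots_pow_self_eq_zero fun z hz => ?_
    have hs' : (s v : ℂ) ≠ 0 := by exact_mod_cast hs0 v
    refine ⟨z / s v, ?_, (mul_div_cancel₀ _ hs').symm⟩
    rw [← hs v, mul_div_cancel₀ _ hs']
    exact hz
  have huniq : ∀ v v', J v = J v' → |s v| = |s v'| := fun v v' h =>
    eq_abs_of_aeval_scaleRoots_pow_eq_zero hf (hs0 v') (hne p) (fun z hz => (hs v' z).2 hz)
      (abs_nonneg _) (h ▸ hself v)
  have hp : |s p| = 1 := by
    symm
    refine eq_abs_of_aeval_scaleRoots_pow_eq_zero hf (hs0 p) (hne p) (fun z hz => (hs p z).2 hz)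
      zero_le_one (m := 1) ?_
    rw [scaleRoots_one, pow_one, map_mul, Matrix.aeval_self_charpoly, zero_mul]
  have hpos : ∀ v, |s v| ≠ 0 := fun v => abs_ne_zero.2 (hs0 v)
  have hroots : ∀ v, (∀ z : ℂ, aeval z (|s v|⁻¹ • J v).charpoly = 0 ↔ aeval z (J p).charpoly = 0) ∨
      ∀ z : ℂ, aeval z (|s v|⁻¹ • J v).charpoly = 0 ↔ aeval (-z) (J p).charpoly = 0 := by
    intro v
    simp only [aeval_charpoly_smul_eq_zero_iff (hpos v)]
    rcases abs_choice (s v) with h | h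
    · left
      intro z
      rw [h, hs]
    · right
      intro z
      rw [h, Complex.ofReal_neg, neg_mul_comm, hs]
  have key := charpoly_eq_of_spectrum_constant_up_to_sign hodd (fun v => |s v|⁻¹ • J v)
    ((hκ.inv₀ hpos).smul hJ) (fun v => by rw [smul_mulVec, hJv, smul_zero])
    (fun v v' h => by rw [heven v v' h, huniq v' v (heven v v' h)]) ?_ ?_ p
  · simpa only [hp, inv_one, one_smul] using key
  · intro v w z hz
    rcases hroots v with hv | hv <;> rcases hroots w with hw | hw <;>
      rw [hv] at hz <;> simp only [hw, neg_neg]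
    · exact Or.inl hz
    · exact Or.inr hz
    · exact Or.inr hz
    · exact Or.inl hz
  · intro v
    obtain ⟨z, hz0, hz⟩ := hne p
    rcases hroots v with hv | hv
    · exact ⟨z, hz0, (hv z).2 hz⟩
    · exact ⟨-z, neg_ne_zero.2 hz0, (hv (-z)).2 (by rwa [neg_neg])⟩

lemma mem_spec {E : Type*} [AddCommGroup E] [Module ℝ E] [FiniteDimensional ℝ E] {f : E →ₗ[ℝ] E}
    {z : ℂ} : z ∈ spec E f ↔ aeval z f.charpoly = 0 := by
  rw [spec, mem_rootSet_of_ne f.charpoly_monic.ne_zero]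

lemma spec_eq_of_charpoly_eq {E : Type*} [AddCommGroup E] [Module ℝ E] [FiniteDimensional ℝ E]
    {f : E →ₗ[ℝ] E} {r : ℝ} {n : ℕ} (hn : n ≠ 0) (h : f.charpoly = X * (X - C r) ^ n) :
    spec E f = {0, (r : ℂ)} := by
  ext z
  simp [mem_spec, h, hn, sub_eq_zero]

lemma trace_eq_of_charpoly_eq {ι : Type*} [Fintype ι] [DecidableEq ι] [Nonempty ι]
    {M : Matrix ι ι ℝ} {r : ℝ} {n : ℕ} (h : M.charpoly = X * (X - C r) ^ n) :
    M.trace = n * r := by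
  have hX : (X : ℝ[X]).nextCoeff = 0 := by simpa using nextCoeff_X_sub_C (0 : ℝ)
  rw [Matrix.trace_eq_neg_charpoly_nextCoeff, h,
    monic_X.nextCoeff_mul ((monic_X_sub_C r).pow n), (monic_X_sub_C r).nextCoeff_pow, hX,
    nextCoeff_X_sub_C]
  simp

lemma forall_pos_or_forall_neg_of_ne_zero {ι : Type*} [Fintype ι] [Nontrivial ι]
    {τ : {v : ι → ℝ // v ≠ 0} → ℝ} (hτ : Continuous τ) (h0 : ∀ v, τ v ≠ 0) :
    (∀ v, 0 < τ v) ∨ ∀ v, τ v < 0 := by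
  have hrank : 1 < Module.rank ℝ (ι → ℝ) := by
    rw [rank_fun']
    exact_mod_cast Fintype.one_lt_card
  have : PreconnectedSpace {v : ι → ℝ // v ≠ 0} :=
    Subtype.preconnectedSpace (isConnected_compl_singleton_of_one_lt_rank hrank 0).isPreconnected
  by_contra! hcon
  obtain ⟨⟨v, hv⟩, w, hw⟩ := hcon
  obtain ⟨u, hu⟩ := mem_range_of_exists_le_of_exists_ge hτ ⟨v, hv⟩ ⟨w, hw⟩
  exact h0 u hu

lemma aeval_zero_charpoly_eq_zero {ι : Type*} [Fintype ι] [DecidableEq ι] {M : Matrix ι ι ℝ}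
    {v : ι → ℝ} (hv : v ≠ 0) (h : M *ᵥ v = 0) : aeval (0 : ℂ) M.charpoly = 0 := by
  have hdet := Matrix.exists_mulVec_eq_zero_iff.1 ⟨v, hv, h⟩
  rw [Matrix.det_eq_sign_charpoly_coeff] at hdet
  have hcoeff := (mul_eq_zero.1 hdet).resolve_left (pow_ne_zero _ (by norm_num))
  rw [← coeff_zero_eq_aeval_zero', hcoeff, map_zero]

lemma jacOp_apply {E : Type*} [AddCommGroup E] [Module ℝ E] (A : E →ₗ[ℝ] E →ₗ[ℝ] E →ₗ[ℝ] E)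
    (v w : E) : jacOp E A v w = A w v v := rfl

lemma continuous_toMatrix_jacOp {ι E : Type*} [Fintype ι] [DecidableEq ι] [AddCommGroup E]
    [Module ℝ E] (A : E →ₗ[ℝ] E →ₗ[ℝ] E →ₗ[ℝ] E) (b : Module.Basis ι ℝ E) :
    Continuous fun x : ι → ℝ => LinearMap.toMatrix b b (jacOp E A (b.equivFun.symm x)) := by
  refine continuous_matrix fun i j => ?_
  simp only [LinearMap.toMatrix_apply, jacOp_apply, Module.Basis.equivFun_symm_apply, map_sum,
    map_smul, LinearMap.sum_apply, LinearMap.smul_apply, Finsupp.coe_finsetSum, Finsupp.coe_smul,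
    Finset.sum_apply, Pi.smul_apply]
  fun_prop

end

/-- Theorem 1.10: for an affine projective Osserman curvature model of odd
dimension `m ≥ 3`, for every nonzero `v` the value `λ(v) := ρ(v,v)/(m−1)` is a
nonzero real number, the characteristic polynomial of `J(v)` is
`t·(t − λ(v))^(m−1)` (so `0` has multiplicity `1` and `λ(v)` multiplicity `m−1`
and `Spec J(v) = {0, λ(v)}`), and the symmetric Ricci form `ρ_s` is definite. -/
theorem stmt_7 [FiniteDimensional ℝ V]
    (A : V →ₗ[ℝ] V →ₗ[ℝ] V →ₗ[ℝ] V)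
    (hanti : ∀ x y z : V, A x y z = - A y x z)
    (hbianchi : ∀ x y z : V, A x y z + A y z x + A z x y = 0)
    (hodd : Odd (Module.finrank ℝ V))
    (hdim : 3 ≤ Module.finrank ℝ V)
    (hoss : ∀ v w : V, v ≠ 0 → w ≠ 0 → ∃ s : ℝ, s ≠ 0 ∧
        spec V (jacOp V A v) = (fun μ : ℂ => (s : ℂ) * μ) '' spec V (jacOp V A w) ∧
        spec V (jacOp V A v) ≠ {0}) :
    (∀ v : V, v ≠ 0 →
      ricci V A v v / ((Module.finrank ℝ V - 1 : ℕ) : ℝ) ≠ 0 ∧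
      (jacOp V A v).charpoly
        = X * (X - C (ricci V A v v / ((Module.finrank ℝ V - 1 : ℕ) : ℝ)))
            ^ (Module.finrank ℝ V - 1) ∧
      spec V (jacOp V A v)
        = {0, ((ricci V A v v / ((Module.finrank ℝ V - 1 : ℕ) : ℝ) : ℝ) : ℂ)}) ∧
    ((∀ v : V, v ≠ 0 → 0 < riccis V A v v) ∨
      (∀ v : V, v ≠ 0 → riccis V A v v < 0)) := by
  set n := Module.finrank ℝ V with hn
  have : Nontrivial (Fin n) := Fin.nontrivial_iff_two_le.2 (by omega)
  let b : Module.Basis (Fin n) ℝ V := Module.finBasis ℝ V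
  let e := b.equivFun
  let J : {x : Fin n → ℝ // x ≠ 0} → Matrix (Fin n) (Fin n) ℝ :=
    fun x => LinearMap.toMatrix b b (jacOp V A (e.symm x))
  have hJ : Continuous J := (continuous_toMatrix_jacOp A b).comp continuous_subtype_val
  have hcharpoly : ∀ x, (J x).charpoly = (jacOp V A (e.symm x)).charpoly :=
    fun x => LinearMap.charpoly_toMatrix _ b
  have hself : ∀ v, jacOp V A v v = 0 := fun v => by
    rw [jacOp_apply]
    have h : (2 : ℝ) • A v v v = 0 := by
      rw [two_smul]
      nth_rewrite 1 [hanti]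
      exact neg_add_cancel _
    exact (smul_eq_zero.1 h).resolve_left two_ne_zero
  have hJv : ∀ x, (J x).mulVec x = 0 := fun x => by
    have h := LinearMap.toMatrix_mulVec_repr b b (jacOp V A (e.symm x)) (e.symm x)
    rw [hself, map_zero] at h
    have h1 : (b.repr (e.symm x) : Fin n → ℝ) = x := e.apply_symm_apply x
    rw [h1] at h
    exact h
  have heven : ∀ x x' : {x : Fin n → ℝ // x ≠ 0}, (x' : Fin n → ℝ) = -x → J x' = J x := by
    intro x x' h
    have : jacOp V A (-e.symm x) = jacOp V A (e.symm x) := by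
      ext w
      simp [jacOp_apply]
    simp only [J, h, map_neg, this]
  have hne0 : ∀ x : {x : Fin n → ℝ // x ≠ 0}, e.symm x ≠ 0 := fun x => by
    simpa using x.2
  have hspec : ∀ v w, ∃ s : ℝ, s ≠ 0 ∧
      ∀ z : ℂ, aeval (s * z) (J v).charpoly = 0 ↔ aeval z (J w).charpoly = 0 := by
    intro v w
    obtain ⟨s, hs, h, -⟩ := hoss _ _ (hne0 v) (hne0 w)
    refine ⟨s, hs, fun z => ?_⟩
    have hinj : Function.Injective fun μ : ℂ => (s : ℂ) * μ :=
      mul_right_injective₀ (by exact_mod_cast hs)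
    rw [hcharpoly, hcharpoly, ← mem_spec, ← mem_spec, h]
    exact hinj.mem_set_image
  have hne : ∀ v, ∃ z : ℂ, z ≠ 0 ∧ aeval z (J v).charpoly = 0 := by
    intro v
    obtain ⟨s, hs, -, h⟩ := hoss _ _ (hne0 v) (hne0 v)
    by_contra! hcon
    refine h (Set.eq_singleton_iff_unique_mem.2 ⟨?_, fun z hz => ?_⟩)
    · rw [mem_spec, ← hcharpoly]
      exact aeval_zero_charpoly_eq_zero v.2 (hJv v)
    · by_contra hz0
      exact hcon z hz0 (by rwa [hcharpoly, ← mem_spec])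
  have key := charpoly_eq_of_spectrum_proportional (by simpa using hodd) J hJ hJv heven hspec hne
  have htrace : ∀ x, (J x).trace = ricci V A (e.symm x) (e.symm x) := fun x =>
    (LinearMap.trace_eq_matrix_trace ℝ b _).symm
  have hn1 : ((n - 1 : ℕ) : ℝ) ≠ 0 := by
    exact_mod_cast (by omega : n - 1 ≠ 0)
  have hmain : ∀ x : {x : Fin n → ℝ // x ≠ 0},
      ricci V A (e.symm x) (e.symm x) / ((n - 1 : ℕ) : ℝ) ≠ 0 ∧
      (J x).charpoly =
        X * (X - C (ricci V A (e.symm x) (e.symm x) / ((n - 1 : ℕ) : ℝ))) ^ (n - 1) := by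
    intro x
    obtain ⟨r, hr, h⟩ := key x
    rw [Fintype.card_fin] at h
    rw [← htrace, trace_eq_of_charpoly_eq h, mul_div_cancel_left₀ _ hn1]
    exact ⟨hr, h⟩
  have hlift : ∀ v : V, v ≠ 0 → ∃ x : {x : Fin n → ℝ // x ≠ 0}, e.symm x = v := fun v hv =>
    ⟨⟨e v, by simpa using hv⟩, e.symm_apply_apply v⟩
  have hricci : ∀ v, riccis V A v v = ricci V A v v := fun v => add_self_div_two _
  refine ⟨fun v hv => ?_, ?_⟩
  · obtain ⟨x, rfl⟩ := hlift v hv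
    obtain ⟨h1, h2⟩ := hmain x
    rw [hcharpoly] at h2
    exact ⟨h1, h2, spec_eq_of_charpoly_eq (by omega) h2⟩
  · refine (forall_pos_or_forall_neg_of_ne_zero hJ.matrix_trace fun x h => (hmain x).1 ?_).imp ?_ ?_
    · rw [← htrace, h, zero_div]
    all_goals
      intro h v hv
      obtain ⟨x, rfl⟩ := hlift v hv
      rw [hricci, ← htrace]
      exact h x
end
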